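/- arXiv:1506.01590 — 10 statements merged into one kernel-verified Lean document; each statement's English description precedes it below -/
import Mathlib

section
/- For every r ∈ (-1,1] and every real y > 1, the series ∑_{l=0}^∞ h_r^{(0)}(l)·y^{-l-1} converges and equals 1/√((y-1)(y+r)), and the series ∑_{l=1}^∞ h_r^{(1)}(l)·y^{-l-1} converges and equals (y-1)^{-3/2}·(y+r)^{-1/2}. -/
open scoped BigOperators

noncomputable def h0 (r : ℝ) (l : ℤ) : ℝ :=
  if 0 ≤ l then
    (4 : ℝ) ^ (-l) *
      ∑ m ∈ Finset.range (l.toNat + 1),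
        (Nat.choose (2 * m) m : ℝ) * (Nat.choose (2 * (l.toNat - m)) (l.toNat - m) : ℝ) *
          (-r) ^ (l.toNat - m)
  else 0

noncomputable def h1 (r : ℝ) (l : ℤ) : ℝ :=
  if 1 ≤ l then ∑ p ∈ Finset.range l.toNat, h0 r (p : ℤ) else 0

noncomputable def h2 (r : ℝ) (l : ℤ) : ℝ :=
  if 2 ≤ l then ∑ p ∈ Finset.Icc 1 (l.toNat - 1), h1 r (p : ℤ) else 0

noncomputable def hm1 (r : ℝ) (l : ℤ) : ℝ := h0 r (l + 1) - h0 r l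

noncomputable def hm2 (r : ℝ) (l : ℤ) : ℝ := hm1 r (l + 1) - hm1 r l

noncomputable def kernelR (r : ℝ) (k m : ℤ) : ℝ :=
  ∑ p ∈ Finset.range m.toNat,
    h1 r (m - (p : ℤ)) * (hm2 r (k + (p : ℤ) - 1) + r * hm2 r (k + (p : ℤ) - 2))

/-- `ν` is a probability distribution on `ℤ`. -/
def IsProbDist (ν : ℤ → ℝ) : Prop := (∀ k, 0 ≤ ν k) ∧ HasSum ν 1

/-- A nonnegative function `f : ℤ → [0,∞)` is `ν`-harmonic on `ℤ_{>0}`. -/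
def NuHarmonic (ν : ℤ → ℝ) (f : ℤ → ℝ) : Prop :=
  (∀ l, 0 ≤ f l) ∧ ∀ k : ℤ, 1 ≤ k → HasSum (fun l : ℤ => f (k + l) * ν l) (f k)

noncomputable def Lnu (r : ℝ) (ν : ℤ → ℝ) : ℝ :=
  ∑' k : ℕ, ν ((k : ℤ) + 1) * h2 r ((k : ℤ) + 2)

noncomputable def phiNu (ν : ℤ → ℝ) (θ : ℝ) : ℂ :=
  ∑' k : ℤ, (ν k : ℂ) * Complex.exp (Complex.I * (k : ℂ) * (θ : ℂ))

theorem cb_multichoose (n : ℕ) :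
    Ring.choose ((1 / 2 : ℝ) + n - 1) n = (Nat.centralBinom n : ℝ) / 4 ^ n := by
  rw [← Ring.multichoose_eq]
  have h := Ring.factorial_nsmul_multichoose_eq_ascPochhammer (1 / 2 : ℝ) n
  rw [Polynomial.ascPochhammer_smeval_eq_eval, nsmul_eq_mul] at h
  have key : ∀ n : ℕ, (ascPochhammer ℝ n).eval (1 / 2 : ℝ)
      = (n.factorial : ℝ) * ((Nat.centralBinom n : ℝ) / 4 ^ n) := by
    intro n
    induction n with
    | zero => simp
    | succ k ih =>
      rw [ascPochhammer_succ_eval, ih, Nat.factorial_succ]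
      have h2 : ((k : ℝ) + 1) * (Nat.centralBinom (k + 1) : ℝ)
          = 2 * (2 * k + 1) * (Nat.centralBinom k : ℝ) := by
        exact_mod_cast Nat.succ_mul_centralBinom_succ k
      push_cast
      have h3 : ((k : ℝ) + 1) * (k.factorial : ℝ) * ((Nat.centralBinom (k + 1) : ℝ) / 4 ^ (k + 1))
          = (k.factorial : ℝ) * (((k : ℝ) + 1) * (Nat.centralBinom (k + 1) : ℝ)) / 4 ^ (k + 1) := by
        ring
      rw [h3, h2, pow_succ]
      field_simp
      ring
  rw [key] at h
  exact mul_left_cancel₀ (by positivity) h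

theorem cb_hasSum (x : ℝ) (hx : |x| < 1) :
    HasSum (fun n : ℕ => (Nat.centralBinom n : ℝ) / 4 ^ n * x ^ n) (1 / Real.sqrt (1 - x)) := by
  have h := Real.one_div_one_sub_rpow_hasFPowerSeriesOnBall_zero (1 / 2)
  have h2 := h.hasSum (y := x) (by
    simp only [Metric.mem_eball, edist_zero_right]
    rw [← ofReal_norm, Real.norm_eq_abs]
    exact ENNReal.ofReal_lt_one.2 hx)
  simp only [zero_add, ← Real.sqrt_eq_rpow] at h2
  convert! h2 using 2 with n
  rw [FormalMultilinearSeries.ofScalars_apply_eq, cb_multichoose, smul_eq_mul]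

theorem cb_summable (x : ℝ) (hx : |x| < 1) :
    Summable (fun n : ℕ => ‖(Nat.centralBinom n : ℝ) / 4 ^ n * x ^ n‖) := by
  convert (cb_hasSum |x| (by rwa [abs_abs])).summable using 2 with n
  rw [norm_mul, norm_pow, Real.norm_eq_abs, Real.norm_eq_abs, abs_of_nonneg (by positivity)]

theorem h0_term (r x : ℝ) (l : ℕ) : h0 r (l : ℤ) * x ^ l =
    ∑ m ∈ Finset.range (l + 1), ((Nat.centralBinom m : ℝ) / 4 ^ m * x ^ m) *
      ((Nat.centralBinom (l - m) : ℝ) / 4 ^ (l - m) * (-r * x) ^ (l - m)) := by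
  unfold h0
  rw [if_pos (by positivity), Int.toNat_natCast, Finset.mul_sum, Finset.sum_mul]
  refine Finset.sum_congr rfl fun m hm => ?_
  obtain ⟨k, rfl⟩ := Nat.exists_eq_add_of_le (Nat.lt_succ_iff.1 (Finset.mem_range.1 hm))
  rw [Nat.add_sub_cancel_left, ← Nat.centralBinom_eq_two_mul_choose,
    ← Nat.centralBinom_eq_two_mul_choose, zpow_neg, zpow_natCast, mul_pow, pow_add, pow_add]
  field_simp

theorem h1_term (r x : ℝ) (l : ℕ) : h1 r ((l : ℤ) + 1) * x ^ l =
    ∑ m ∈ Finset.range (l + 1), (h0 r (m : ℤ) * x ^ m) * x ^ (l - m) := by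
  unfold h1
  have e : ((l : ℤ) + 1).toNat = l + 1 := by omega
  rw [if_pos (by omega), e, Finset.sum_mul]
  refine Finset.sum_congr rfl fun m hm => ?_
  obtain ⟨k, rfl⟩ := Nat.exists_eq_add_of_le (Nat.lt_succ_iff.1 (Finset.mem_range.1 hm))
  rw [Nat.add_sub_cancel_left, pow_add]
  ring

/-- generating functions of `h_r^{(0)}` and `h_r^{(1)}`. -/
theorem stmt0 (r : ℝ) (hr : r ∈ Set.Ioc (-1 : ℝ) 1) (y : ℝ) (hy : 1 < y) :
    HasSum (fun l : ℕ => h0 r (l : ℤ) * y ^ (-(l : ℤ) - 1))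
      (1 / Real.sqrt ((y - 1) * (y + r))) ∧
    HasSum (fun l : ℕ => h1 r ((l : ℤ) + 1) * y ^ (-(l : ℤ) - 2))
      ((y - 1) ^ (-(3 : ℝ) / 2) * (y + r) ^ (-(1 : ℝ) / 2)) := by
  obtain ⟨hr1, hr2⟩ := hr
  have hy0 : 0 < y := by linarith
  have hya : 0 < y - 1 := by linarith
  have hyb : 0 < y + r := by linarith
  have hx : |y⁻¹| < 1 := by
    rw [abs_of_pos (by positivity)]
    exact inv_lt_one_of_one_lt₀ hy
  have hx2 : |-r * y⁻¹| < 1 := by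
    rw [abs_mul, abs_neg]
    have : |r| ≤ 1 := abs_le.2 ⟨hr1.le, hr2⟩
    nlinarith [abs_nonneg r, abs_nonneg y⁻¹]
  have S1 := cb_summable _ hx
  have S2 := cb_summable _ hx2
  have H0 := hasSum_sum_range_mul_of_summable_norm S1 S2
  have N0 := summable_norm_sum_mul_range_of_summable_norm S1 S2
  rw [(cb_hasSum _ hx).tsum_eq, (cb_hasSum _ hx2).tsum_eq] at H0
  simp only [← h0_term] at H0 N0
  have G : Summable (fun n : ℕ => ‖(y⁻¹) ^ n‖) := by
    simpa only [norm_pow] using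
      summable_geometric_of_lt_one (norm_nonneg _) (by simpa only [Real.norm_eq_abs] using hx)
  have H1 := hasSum_sum_range_mul_of_summable_norm N0 G
  rw [H0.tsum_eq, tsum_geometric_of_norm_lt_one (by simpa only [Real.norm_eq_abs] using hx)] at H1
  simp only [← h1_term] at H1
  have e1 : 1 - y⁻¹ = (y - 1) / y := by field_simp
  have e2 : 1 - -r * y⁻¹ = (y + r) / y := by field_simp; ring
  rw [e1, e2] at H0 H1
  have sy : Real.sqrt y * Real.sqrt y = y := Real.mul_self_sqrt hy0.le
  have s0 : 0 < Real.sqrt y := Real.sqrt_pos.2 hy0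
  have sa : 0 < Real.sqrt (y - 1) := Real.sqrt_pos.2 hya
  have sb : 0 < Real.sqrt (y + r) := Real.sqrt_pos.2 hyb
  have V : 1 / Real.sqrt ((y - 1) / y) * (1 / Real.sqrt ((y + r) / y)) =
      y / (Real.sqrt (y - 1) * Real.sqrt (y + r)) := by
    rw [Real.sqrt_div hya.le, Real.sqrt_div hyb.le]
    field_simp
    nlinarith
  rw [V] at H0 H1
  constructor
  · convert! H0.mul_right y⁻¹ using 1
    · funext l
      rw [mul_assoc, ← pow_succ, inv_pow, ← zpow_natCast, ← zpow_neg]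
      congr 2
      push_cast
      ring
    · rw [Real.sqrt_mul hya.le]
      field_simp
  · convert! H1.mul_right (y⁻¹ ^ 2) using 1
    · funext l
      rw [mul_assoc, ← pow_add, inv_pow, ← zpow_natCast, ← zpow_neg]
      congr 2
      push_cast
      ring
    · have a1 : (y - 1) ^ (-(3 : ℝ) / 2) = ((y - 1) * Real.sqrt (y - 1))⁻¹ := by
        rw [show (-(3 : ℝ) / 2) = -(1 + 1 / 2) by norm_num, Real.rpow_neg hya.le,
          Real.rpow_add hya, Real.rpow_one, Real.sqrt_eq_rpow]
      have a2 : (y + r) ^ (-(1 : ℝ) / 2) = (Real.sqrt (y + r))⁻¹ := by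
        rw [show (-(1 : ℝ) / 2) = -(1 / 2) by norm_num, Real.rpow_neg hyb.le, Real.sqrt_eq_rpow]
      rw [a1, a2]
      field_simp
end

section
/- For every r ∈ (-1,1) and every integer k with -2 ≤ k ≤ 2, one has lim_{l→∞} l^{1/2-k}·h_r^{(k)}(l) = 1/(Γ(k+1/2)·√(1+r)), where Γ is the Gamma function. -/
open scoped BigOperators

/-- The family `h_r^{(k)}` for `k ∈ {-2,-1,0,1,2}`. -/
noncomputable def hfam (r : ℝ) (k l : ℤ) : ℝ :=
  if k = 0 then h0 r l
  else if k = 1 then h1 r l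
  else if k = 2 then h2 r l
  else if k = -1 then hm1 r l
  else if k = -2 then hm2 r l
  else 0

open Filter Topology

lemma shift_lim (s L : ℝ) (f : ℕ → ℝ) (p q : ℕ)
    (h : Tendsto (fun n : ℕ => (n : ℝ) ^ s * f n) atTop (𝓝 L)) :
    Tendsto (fun n : ℕ => ((n : ℝ) + p) ^ s * f (n + q)) atTop (𝓝 L) := by
  have h1 := h.comp (tendsto_add_atTop_nat q)
  have h2 : Tendsto (fun n : ℕ => (((n : ℝ) + p) / ((n : ℝ) + q))) atTop (𝓝 1) := by
    have := tendsto_add_mul_div_add_mul_atTop_nhds (p : ℝ) (q : ℝ) 1 (one_ne_zero (α := ℝ))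
    simpa [add_comm] using this
  have h3 := (h2.rpow_const (p := s) (Or.inl one_ne_zero)).mul h1
  rw [Real.one_rpow, one_mul] at h3
  refine h3.congr' ?_
  filter_upwards [eventually_ge_atTop 1] with n hn
  have hn' : (1 : ℝ) ≤ n := by exact_mod_cast hn
  have hp : (0 : ℝ) < n + p := by positivity
  have hq : (0 : ℝ) < n + q := by positivity
  have := (Real.rpow_pos_of_pos hq s).ne'
  simp only [Function.comp]
  rw [Real.div_rpow hp.le hq.le]
  push_cast
  field_simp

lemma conv_lim (s A B ρ : ℝ) (N : ℕ) (hs : s ≤ N) (hρ0 : 0 ≤ ρ) (hρ : ρ < 1) (a b : ℕ → ℝ)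
    (ha : Tendsto (fun n : ℕ => (n : ℝ) ^ s * a n) atTop (𝓝 A))
    (hb : ∀ n, |b n| ≤ ρ ^ n) (hB : HasSum b B) :
    Tendsto (fun n : ℕ => (n : ℝ) ^ s * ∑ j ∈ Finset.range (n + 1), a (n - j) * b j)
      atTop (𝓝 (A * B)) := by
  have ha1 := shift_lim s A a 1 0 ha
  obtain ⟨C, hC⟩ := ha1.abs.bddAbove_range
  have hC' : ∀ n : ℕ, |((n : ℝ) + 1) ^ s * a n| ≤ C := by
    intro n; simpa using hC (Set.mem_range_self n)
  have hC0 : 0 ≤ C := (abs_nonneg _).trans (hC' 0)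
  have key : Tendsto (fun n : ℕ => ∑' j : ℕ, if j ≤ n then ((n : ℝ) + 1) ^ s * a (n - j) * b j else 0)
      atTop (𝓝 (∑' j, A * b j)) := by
    refine tendsto_tsum_of_dominated_convergence
      (bound := fun j : ℕ => C * (((j : ℝ) + 1) ^ N * ρ ^ j)) ?_ ?_ ?_
    · apply Summable.mul_left
      rcases hρ0.eq_or_lt with h | h
      · subst h
        apply summable_of_ne_finset_zero (s := {0})
        intro j hj
        simp at hj
        simp [hj]
      have h1 := (summable_nat_add_iff 1).2 (summable_pow_mul_geometric_of_norm_lt_one N (r := ρ)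
        (by rwa [Real.norm_eq_abs, abs_of_nonneg hρ0]))
      have := h1.mul_left ρ⁻¹
      refine this.congr fun j => ?_
      push_cast
      rw [pow_succ ρ]
      field_simp
    · intro j
      have h1 := (shift_lim s A a (j + 1) 0 ha).mul_const (b j)
      rw [← tendsto_add_atTop_iff_nat j]
      refine h1.congr fun n => ?_
      simp [add_assoc]
    · refine Eventually.of_forall fun n j => ?_
      split_ifs with hj
      · obtain ⟨m, rfl⟩ := Nat.exists_eq_add_of_le hj
        rw [Nat.add_sub_cancel_left, norm_mul, Real.norm_eq_abs, Real.norm_eq_abs, ← mul_assoc]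
        refine mul_le_mul ?_ (hb j) (abs_nonneg _) (by positivity)
        have hm : (0 : ℝ) < m + 1 := by positivity
        have hx : (0 : ℝ) < ((j + m : ℕ) : ℝ) + 1 := by positivity
        have hq : ((((j + m : ℕ) : ℝ) + 1) / (m + 1)) ^ s ≤ ((j : ℝ) + 1) ^ N := by
          have h1 : 1 ≤ (((j + m : ℕ) : ℝ) + 1) / (m + 1) := by
            rw [le_div_iff₀ hm]; push_cast; have : (0 : ℝ) ≤ j := by positivity
            linarith
          have h2 : (((j + m : ℕ) : ℝ) + 1) / (m + 1) ≤ (j : ℝ) + 1 := by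
            rw [div_le_iff₀ hm]; push_cast
            have : (0 : ℝ) ≤ j * m := by positivity
            nlinarith
          calc _ ≤ ((((j + m : ℕ) : ℝ) + 1) / (m + 1)) ^ (N : ℝ) :=
                Real.rpow_le_rpow_of_exponent_le h1 hs
            _ = ((((j + m : ℕ) : ℝ) + 1) / (m + 1)) ^ N := Real.rpow_natCast _ _
            _ ≤ _ := pow_le_pow_left₀ (by positivity) h2 N
        have e : (((j + m : ℕ) : ℝ) + 1) ^ s * a m
            = ((((j + m : ℕ) : ℝ) + 1) / (m + 1)) ^ s * (((m : ℝ) + 1) ^ s * a m) := by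
          rw [Real.div_rpow hx.le hm.le]
          have := (Real.rpow_pos_of_pos hm s).ne'
          field_simp
        rw [e, abs_mul, abs_of_nonneg (by positivity), mul_comm C]
        exact mul_le_mul hq (hC' m) (abs_nonneg _) (by positivity)
      · rw [norm_zero]; positivity
  rw [tsum_mul_left, hB.tsum_eq] at key
  have key2 : Tendsto (fun n : ℕ => ((n : ℝ) + 1) ^ s *
      ∑ j ∈ Finset.range (n + 1), a (n - j) * b j) atTop (𝓝 (A * B)) := by
    refine key.congr fun n => ?_
    rw [tsum_eq_sum (s := Finset.range (n + 1)), Finset.mul_sum]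
    · refine Finset.sum_congr rfl fun j hj => ?_
      rw [if_pos (by simpa [Nat.lt_succ_iff] using hj), mul_assoc]
    · intro j hj
      rw [if_neg (by simpa using hj)]
  rw [← tendsto_add_atTop_iff_nat 1]
  have h5 := (tendsto_add_atTop_iff_nat 1).2 key2
  have h6 := shift_lim 0 1 (fun _ => 1) 0 0 (by simp)
  -- shift back
  have h2 : Tendsto (fun n : ℕ => (((n : ℝ) + 1) / ((n : ℝ) + 2))) atTop (𝓝 1) := by
    have := tendsto_add_mul_div_add_mul_atTop_nhds (1 : ℝ) (2 : ℝ) 1 (one_ne_zero (α := ℝ))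
    simpa [add_comm] using this
  have h3 := (h2.rpow_const (p := s) (Or.inl one_ne_zero)).mul h5
  rw [Real.one_rpow, one_mul] at h3
  refine h3.congr fun n => ?_
  have hp : (0 : ℝ) < n + 1 := by positivity
  have hq : (0 : ℝ) < n + 2 := by positivity
  have := (Real.rpow_pos_of_pos hq s).ne'
  rw [Real.div_rpow hp.le hq.le]
  push_cast
  rw [show (n : ℝ) + 1 + 1 = n + 2 by ring]
  field_simp

noncomputable def gco (α : ℝ) : ℕ → ℝ
  | 0 => 1
  | n + 1 => gco α n * (α + n) / (n + 1)

lemma gco_diff (α : ℝ) (n : ℕ) : gco α (n + 1) - gco α n = gco (α - 1) (n + 1) := by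
  have h : ∀ n : ℕ, gco (α - 1) (n + 1) = gco α n * (α - 1) / (n + 1) := by
    intro n
    induction n with
    | zero => simp [gco]
    | succ n ih =>
      rw [gco, ih, gco]
      push_cast
      field_simp
      ring
  rw [h, gco]
  field_simp
  ring

lemma gco_prod (α : ℝ) (n : ℕ) : gco α n * n.factorial = ∏ j ∈ Finset.range n, (α + j) := by
  induction n with
  | zero => simp [gco]
  | succ n ih =>
    rw [Finset.prod_range_succ, ← ih, gco, Nat.factorial_succ]
    push_cast
    field_simp

lemma gco_lim (α : ℝ) (hα : ∀ m : ℕ, α ≠ -m) :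
    Tendsto (fun n : ℕ => (n : ℝ) ^ (1 - α) * gco α n) atTop (𝓝 (1 / Real.Gamma α)) := by
  have h1 := Real.GammaSeq_tendsto_Gamma α
  have h2 : Tendsto (fun n : ℕ => ((n : ℝ) / ((n : ℝ) + α))) atTop (𝓝 1) := by
    have := tendsto_add_mul_div_add_mul_atTop_nhds (0 : ℝ) α 1 (one_ne_zero (α := ℝ))
    simpa [add_comm] using this
  have h3 := h2.div h1 (Real.Gamma_ne_zero hα)
  refine h3.congr' ?_
  filter_upwards [eventually_ge_atTop 1] with n hn
  have hn' : (0 : ℝ) < n := by exact_mod_cast hn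
  have hne : ∀ j : ℕ, α + j ≠ 0 := fun j h => hα j (by linarith)
  have hne' : (n : ℝ) + α ≠ 0 := by rw [add_comm]; exact hne n
  have hf : (n.factorial : ℝ) ≠ 0 := by positivity
  have hg : gco α n ≠ 0 := by
    intro h
    have := gco_prod α n
    rw [h, zero_mul] at this
    exact Finset.prod_ne_zero_iff.2 (fun j _ => hne j) this.symm
  simp only [Pi.div_apply]
  rw [Real.GammaSeq, Finset.prod_range_succ, ← gco_prod, Real.rpow_sub hn', Real.rpow_one,
    add_comm α]
  have := (Real.rpow_pos_of_pos hn' α).ne'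
  field_simp

lemma gco_half (n : ℕ) : gco (1 / 2) n = (Nat.choose (2 * n) n : ℝ) / 4 ^ n := by
  induction n with
  | zero => simp [gco]
  | succ n ih =>
    have h : ((n : ℝ) + 1) * (Nat.choose (2 * (n + 1)) (n + 1) : ℝ)
        = 2 * (2 * n + 1) * (Nat.choose (2 * n) n : ℝ) := by
      have := Nat.succ_mul_centralBinom_succ n
      simp only [Nat.centralBinom] at this
      exact_mod_cast this
    rw [gco, ih, pow_succ]
    field_simp
    linarith

lemma gco_half_bd (n : ℕ) : 0 ≤ gco (1 / 2) n ∧ gco (1 / 2) n ≤ 1 := by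
  induction n with
  | zero => simp [gco]
  | succ n ih =>
    rw [gco]
    have := ih.1
    refine ⟨by positivity, ?_⟩
    rw [div_le_one (by positivity)]
    nlinarith [ih.2, (Nat.cast_nonneg n : (0 : ℝ) ≤ n)]

lemma gco_choose (α : ℝ) (n : ℕ) : gco α n = Ring.choose (α + n - 1) n := by
  rw [← Ring.multichoose_eq]
  have h := Ring.factorial_nsmul_multichoose_eq_ascPochhammer α n
  rw [Polynomial.ascPochhammer_smeval_eq_eval, nsmul_eq_mul] at h
  have h2 : (ascPochhammer ℝ n).eval α = ∏ j ∈ Finset.range n, (α + j) := by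
    induction n with
    | zero => simp
    | succ n ih => rw [ascPochhammer_succ_eval, Finset.prod_range_succ,
        ih (by rw [← Polynomial.ascPochhammer_smeval_eq_eval,
          ← Ring.factorial_nsmul_multichoose_eq_ascPochhammer, nsmul_eq_mul])]
  rw [h2, ← gco_prod, mul_comm] at h
  exact (mul_right_cancel₀ (by positivity) h).symm

lemma bsum (r : ℝ) (hr : r ∈ Set.Ioo (-1 : ℝ) 1) :
    HasSum (fun n : ℕ => gco (1 / 2) n * (-r) ^ n) (1 / Real.sqrt (1 + r)) := by
  have h := (Real.one_div_one_sub_rpow_hasFPowerSeriesOnBall_zero (1 / 2)).hasSum (y := -r) (by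
    simp only [Metric.mem_eball, edist_zero_right]
    rw [← ofReal_norm, ENNReal.ofReal_lt_one, norm_neg, Real.norm_eq_abs, abs_lt]
    exact hr)
  simp only [zero_add, sub_neg_eq_add, ← Real.sqrt_eq_rpow] at h
  refine Eq.mp (congrArg (fun f : ℕ → ℝ => HasSum f (1 / Real.sqrt (1 + r))) (funext fun n => ?_)) h
  simp [FormalMultilinearSeries.ofScalars, gco_choose]

noncomputable def Hc (r α : ℝ) (n : ℕ) : ℝ :=
  ∑ j ∈ Finset.range (n + 1), gco α (n - j) * (gco (1 / 2) j * (-r) ^ j)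

lemma Hc_lim (r : ℝ) (hr : r ∈ Set.Ioo (-1 : ℝ) 1) (α : ℝ) (hα : ∀ m : ℕ, α ≠ -m) (N : ℕ)
    (hN : 1 - α ≤ N) :
    Tendsto (fun n : ℕ => (n : ℝ) ^ (1 - α) * Hc r α n) atTop
      (𝓝 (1 / (Real.Gamma α * Real.sqrt (1 + r)))) := by
  have := conv_lim (1 - α) _ _ |r| N hN (abs_nonneg _) (abs_lt.2 hr) _ _ (gco_lim α hα)
    (fun n => ?_) (bsum r hr)
  · rw [one_div_mul_one_div] at this
    exact this
  · rw [abs_mul, abs_pow, abs_neg, abs_of_nonneg (gco_half_bd n).1]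
    exact mul_le_of_le_one_left (by positivity) (gco_half_bd n).2

lemma Hc_diff (r α : ℝ) (n : ℕ) : Hc r α (n + 1) - Hc r α n = Hc r (α - 1) (n + 1) := by
  unfold Hc
  rw [Finset.sum_range_succ, Finset.sum_range_succ (n := n + 1), add_sub_right_comm,
    ← Finset.sum_sub_distrib]
  congr 1
  · refine Finset.sum_congr rfl fun j hj => ?_
    have : j ≤ n := by simpa [Nat.lt_succ_iff] using hj
    rw [Nat.succ_sub this, ← gco_diff]
    ring
  · simp [gco]

lemma Hc_zero (r α : ℝ) : Hc r α 0 = 1 := by simp [Hc, gco]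

lemma Hc_sum (r α : ℝ) (n : ℕ) : ∑ p ∈ Finset.range (n + 1), Hc r α p = Hc r (α + 1) n := by
  induction n with
  | zero => simp [Hc_zero]
  | succ n ih =>
    have := Hc_diff r (α + 1) n
    rw [add_sub_cancel_right] at this
    rw [Finset.sum_range_succ, ih]
    linarith

lemma h0_eq (r : ℝ) (n : ℕ) : h0 r (n : ℤ) = Hc r (1 / 2) n := by
  unfold h0 Hc
  rw [if_pos (by positivity), Int.toNat_natCast, ← Finset.sum_range_reflect, Finset.mul_sum]
  refine Finset.sum_congr rfl fun j hj => ?_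
  have hj' : j ≤ n := by simpa [Nat.lt_succ_iff] using hj
  obtain ⟨m, rfl⟩ := Nat.exists_eq_add_of_le hj'
  rw [show j + m + 1 - 1 - j = m by omega, show j + m - m = j by omega,
    show j + m - j = m by omega, gco_half, gco_half, zpow_neg, zpow_natCast, pow_add]
  field_simp

lemma h1_eq (r : ℝ) (n : ℕ) : h1 r ((n + 1 : ℕ) : ℤ) = Hc r (3 / 2) n := by
  unfold h1
  rw [if_pos (by push_cast; omega), Int.toNat_natCast]
  simp only [h0_eq]
  rw [Hc_sum]
  norm_num

lemma h2_eq (r : ℝ) (n : ℕ) : h2 r ((n + 2 : ℕ) : ℤ) = Hc r (5 / 2) n := by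
  unfold h2
  rw [if_pos (by push_cast; omega), Int.toNat_natCast]
  have e : Finset.Icc 1 (n + 2 - 1) = Finset.Ico 1 (n + 2) := by ext; simp; omega
  rw [e, Finset.sum_Ico_eq_sum_range]
  simp only [add_comm 1, h1_eq]
  rw [show n + 2 - 1 = n + 1 by omega, Hc_sum]
  norm_num

lemma hm1_eq (r : ℝ) (n : ℕ) : hm1 r (n : ℤ) = Hc r (-1 / 2) (n + 1) := by
  unfold hm1
  have := h0_eq r (n + 1)
  push_cast at this
  rw [this, h0_eq, Hc_diff]
  norm_num

lemma hm2_eq (r : ℝ) (n : ℕ) : hm2 r (n : ℤ) = Hc r (-3 / 2) (n + 2) := by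
  unfold hm2
  have := hm1_eq r (n + 1)
  push_cast at this
  rw [this, hm1_eq, Hc_diff]
  norm_num

lemma Hc_lim' (r : ℝ) (hr : r ∈ Set.Ioo (-1 : ℝ) 1) (k : ℤ) (hk : -2 ≤ k) (p q : ℕ) :
    Tendsto (fun n : ℕ => ((n : ℝ) + p) ^ ((1 : ℝ) / 2 - k) * Hc r (k + 1 / 2) (n + q)) atTop
      (𝓝 (1 / (Real.Gamma ((k : ℝ) + 1 / 2) * Real.sqrt (1 + r)))) := by
  have hk' : (-2 : ℝ) ≤ k := by exact_mod_cast hk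
  have := Hc_lim r hr (k + 1 / 2) (fun m h => by
    have h2 : ((2 * k + 1 + 2 * m : ℤ) : ℝ) = 0 := by push_cast; linarith
    have : 2 * k + 1 + 2 * (m : ℤ) = 0 := by exact_mod_cast h2
    omega) 3 (by push_cast; linarith)
  rw [show 1 - ((k : ℝ) + 1 / 2) = 1 / 2 - k by ring] at this
  exact shift_lim _ _ _ p q this

/-- asymptotics of `h_r^{(k)}`. -/
theorem stmt1 (r : ℝ) (hr : r ∈ Set.Ioo (-1 : ℝ) 1) (k : ℤ) (hk1 : -2 ≤ k) (hk2 : k ≤ 2) :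
    Filter.Tendsto (fun l : ℕ => (l : ℝ) ^ ((1 : ℝ) / 2 - (k : ℝ)) * hfam r k (l : ℤ))
      Filter.atTop
      (nhds (1 / (Real.Gamma ((k : ℝ) + 1 / 2) * Real.sqrt (1 + r)))) := by
  have hm2 := Hc_lim' r hr k hk1
  obtain rfl | rfl | rfl | rfl | rfl : k = -2 ∨ k = -1 ∨ k = 0 ∨ k = 1 ∨ k = 2 := by omega
  · refine (hm2 0 2).congr fun n => ?_
    simp only [hfam]
    norm_num [hm2_eq]
  · refine (hm2 0 1).congr fun n => ?_
    simp only [hfam]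
    norm_num [hm1_eq]
  · refine (hm2 0 0).congr fun n => ?_
    simp only [hfam]
    norm_num [h0_eq]
  · rw [← tendsto_add_atTop_iff_nat 1]
    refine (hm2 1 0).congr fun n => ?_
    simp only [hfam]
    rw [h1_eq]
    norm_num
  · rw [← tendsto_add_atTop_iff_nat 2]
    refine (hm2 2 0).congr fun n => ?_
    simp only [hfam]
    rw [h2_eq]
    norm_num
end

section
/- Suppose r ∈ (-1,1], ν is a probability distribution on ℤ with ν(-2) > 0, and h_r^{(0)} is ν-harmonic on ℤ_{>0}. Then ∑_{l=0}^∞ h_r^{(1)}(l+1)·ν(l) ≤ 1. -/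
open scoped BigOperators

open Filter Topology ENNReal

lemma tsum_iSup_of_mono {f : ℕ → ℤ → ℝ≥0∞} (hf : Monotone f) :
    ∑' j, (⨆ n, f n j) = ⨆ n, ∑' j, f n j := by
  have h := MeasureTheory.lintegral_iSup (μ := (MeasureTheory.Measure.count : MeasureTheory.Measure ℤ))
    (f := f) (fun n => measurable_of_countable _) hf
  simpa [MeasureTheory.lintegral_count] using h

noncomputable def Pop (N g : ℤ → ℝ≥0∞) (k : ℤ) : ℝ≥0∞ := ∑' j, g j * N (j - k)

noncomputable def stepOp (N g : ℤ → ℝ≥0∞) (k : ℤ) : ℝ≥0∞ :=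
  if k = 0 then 1 else if k < 0 then 0 else Pop N g k

noncomputable def Gn (N : ℤ → ℝ≥0∞) : ℕ → ℤ → ℝ≥0∞
  | 0 => fun _ => 0
  | n + 1 => stepOp N (Gn N n)

lemma Pop_mono (N : ℤ → ℝ≥0∞) {f g : ℤ → ℝ≥0∞} (h : f ≤ g) : Pop N f ≤ Pop N g := by
  intro k
  exact ENNReal.tsum_le_tsum fun j => mul_le_mul_left (h j) _

lemma stepOp_mono (N : ℤ → ℝ≥0∞) {f g : ℤ → ℝ≥0∞} (h : f ≤ g) : stepOp N f ≤ stepOp N g := by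
  intro k
  unfold stepOp
  split_ifs
  · exact le_rfl
  · exact le_rfl
  · exact Pop_mono N h k

lemma Gn_le_succ (N : ℤ → ℝ≥0∞) (n : ℕ) : Gn N n ≤ Gn N (n + 1) := by
  induction n with
  | zero => intro k; simp [Gn]
  | succ n ih => exact stepOp_mono N ih

lemma Gn_mono (N : ℤ → ℝ≥0∞) : Monotone (Gn N) := monotone_nat_of_le_succ (Gn_le_succ N)

lemma split_int (f : ℤ → ℝ≥0∞) :
    ∑' k, f k = ∑' k : ℕ, f (-(k : ℤ)) + ∑' k : ℕ, f ((k : ℤ) + 1) := by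
  have h1 : HasSum (fun k : ℕ => f (-(k : ℤ))) (∑' k : ℕ, f (-(k : ℤ))) := ENNReal.summable.hasSum
  have h2 : HasSum (fun k : ℕ => f ((k : ℤ) + 1)) (∑' k : ℕ, f ((k : ℤ) + 1)) :=
    ENNReal.summable.hasSum
  have h := HasSum.of_nat_of_neg_add_one (f := fun k : ℤ => f (-k)) h1 (by simpa using h2)
  rw [← h.tsum_eq, ← (Equiv.neg ℤ).tsum_eq f]
  rfl

lemma tsum_Pop (N : ℤ → ℝ≥0∞) (hN : ∑' k, N k = 1) (g : ℤ → ℝ≥0∞) :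
    ∑' k, Pop N g k = ∑' j, g j := by
  unfold Pop
  rw [ENNReal.tsum_comm]
  refine tsum_congr fun j => ?_
  rw [ENNReal.tsum_mul_left]
  have : ∑' k, N (j - k) = 1 := by
    rw [← hN, ← (Equiv.subLeft j).tsum_eq N]; rfl
  rw [this, mul_one]

lemma tsum_stepOp (N g : ℤ → ℝ≥0∞) :
    ∑' k, stepOp N g k = 1 + ∑' k : ℕ, Pop N g ((k : ℤ) + 1) := by
  rw [split_int]
  congr 1
  · rw [tsum_eq_single 0]
    · simp [stepOp]
    · intro k hk
      have h1 : -(k : ℤ) ≠ 0 := by omega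
      have h2 : -(k : ℤ) < 0 := by omega
      simp only [stepOp, if_neg h1, if_pos h2]

lemma Gn_fin (N : ℤ → ℝ≥0∞) (hN : ∑' k, N k = 1) (n : ℕ) : ∑' k, Gn N n k ≠ ⊤ := by
  induction n with
  | zero => simp [Gn]
  | succ n ih =>
    have h := split_int (Pop N (Gn N n))
    rw [tsum_Pop N hN] at h
    change ∑' k, stepOp N (Gn N n) k ≠ ⊤
    rw [tsum_stepOp]
    refine ENNReal.add_ne_top.2 ⟨ENNReal.one_ne_top, ?_⟩
    refine ne_top_of_le_ne_top ih ?_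
    rw [h]; exact le_add_self

lemma out_Gn (N : ℤ → ℝ≥0∞) (hN : ∑' k, N k = 1) (n : ℕ) :
    ∑' k : ℕ, Pop N (Gn N n) (-(k : ℤ)) ≤ 1 := by
  have h := split_int (Pop N (Gn N n))
  rw [tsum_Pop N hN] at h
  have h2 : ∑' k, Gn N n k ≤ 1 + ∑' k : ℕ, Pop N (Gn N n) ((k : ℤ) + 1) := by
    rw [← tsum_stepOp]
    exact ENNReal.tsum_le_tsum (Gn_le_succ N n)
  rw [h] at h2
  have hT : ∑' k : ℕ, Pop N (Gn N n) ((k : ℤ) + 1) ≠ ⊤ := by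
    refine ne_top_of_le_ne_top (Gn_fin N hN n) ?_
    rw [h]; exact le_add_self
  exact (ENNReal.add_le_add_iff_right hT).1 h2

lemma Pop_iSup (N : ℤ → ℝ≥0∞) (k : ℤ) :
    Pop N (fun j => ⨆ n, Gn N n j) k = ⨆ n, Pop N (Gn N n) k := by
  unfold Pop
  simp_rw [ENNReal.iSup_mul]
  apply tsum_iSup_of_mono (f := fun n j => Gn N n j * N (j - k))
  intro a b hab j
  exact mul_le_mul_left (Gn_mono N hab j) _

lemma out_sup (N : ℤ → ℝ≥0∞) (hN : ∑' k, N k = 1) :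
    ∑' k : ℕ, Pop N (fun j => ⨆ n, Gn N n j) (-(k : ℤ)) ≤ 1 := by
  rw [ENNReal.tsum_eq_iSup_sum]
  refine iSup_le fun s => ?_
  simp_rw [Pop_iSup]
  rw [ENNReal.finsetSum_iSup_of_monotone]
  · refine iSup_le fun n => ?_
    exact (ENNReal.sum_le_tsum s).trans (out_Gn N hN n)
  · intro k a b hab
    exact Pop_mono N (Gn_mono N hab) _

lemma core (a N : ℤ → ℝ≥0∞) (hN : ∑' k, N k = 1) (hneg : ∀ k < 0, a k = 0) (ha0 : a 0 = 1)
    (hfin : ∀ k, a k ≠ ⊤) (hlim : Tendsto (fun n : ℕ => a n) atTop (𝓝 0))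
    (harm : ∀ k : ℤ, 1 ≤ k → Pop N a k = a k) (hN2 : N (-2) ≠ 0) :
    ∑' k : ℕ, Pop N a (-(k : ℤ)) ≤ 1 := by
  have hfix : stepOp N a = a := by
    funext k
    unfold stepOp
    split_ifs with h1 h2
    · rw [h1, ha0]
    · rw [hneg k h2]
    · exact harm k (by omega)
  have hle : ∀ n, Gn N n ≤ a := by
    intro n
    induction n with
    | zero => intro k; simp [Gn]
    | succ n ih =>
      have := stepOp_mono N ih
      rw [hfix] at this
      exact this
  set S : ℤ → ℝ≥0∞ := fun j => ⨆ n, Gn N n j with hS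
  have hSle : ∀ k, S k ≤ a k := fun k => iSup_le fun n => hle n k
  have hSfin : ∀ k, S k ≠ ⊤ := fun k => ne_top_of_le_ne_top (hfin k) (hSle k)
  have hShift : ∀ k, S k = ⨆ n, Gn N (n + 1) k := fun k => by
    refine le_antisymm (iSup_le fun n => ?_) (iSup_le fun n => ?_)
    · exact (Gn_le_succ N n k).trans (le_iSup (fun n => Gn N (n + 1) k) n)
    · exact le_iSup (fun n => Gn N n k) (n + 1)
  have hS0 : S 0 = 1 := by
    rw [hShift]; simp [Gn, stepOp]
  have hSk : ∀ k : ℤ, 1 ≤ k → Pop N S k = S k := by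
    intro k hk
    rw [hShift k, hS, Pop_iSup]
    have h1 : ¬ (k = 0) := by omega
    have h2 : ¬ (k < 0) := by omega
    simp only [Gn, stepOp, if_neg h1, if_neg h2]
  obtain ⟨e, he⟩ : ∃ e : ℤ → ℝ≥0∞, e = fun k => a k - S k := ⟨_, rfl⟩
  have hSe : ∀ k, S k + e k = a k := fun k => by
    rw [he]; exact add_tsub_cancel_of_le (hSle k)
  have hele : ∀ k, e k ≤ a k := fun k => by rw [← hSe k]; exact le_add_self
  have hefin : ∀ k, e k ≠ ⊤ := fun k => ne_top_of_le_ne_top (hfin k) (hele k)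
  have he0 : ∀ k : ℤ, k ≤ 0 → e k = 0 := by
    intro k hk
    rcases hk.lt_or_eq with h | h
    · exact le_antisymm ((hele k).trans (hneg k h).le) bot_le
    · rw [he, h]; simp [ha0, hS0]
  have heh : ∀ k : ℤ, 1 ≤ k → Pop N e k = e k := by
    intro k hk
    have h := harm k hk
    have h3 : Pop N a k = Pop N S k + Pop N e k := by
      unfold Pop
      rw [← ENNReal.tsum_add]
      refine tsum_congr fun j => ?_
      rw [← add_mul, hSe]
    rw [h3, hSk k hk, ← hSe k] at h
    exact (ENNReal.add_right_inj (hSfin k)).1 h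
  have hez : ∀ n : ℕ, e n = 0 := by
    by_contra! hcon
    obtain ⟨m0, hm0⟩ := hcon
    have hlim2 : Tendsto (fun n : ℕ => e n) atTop (𝓝 0) :=
      tendsto_of_tendsto_of_tendsto_of_le_of_le tendsto_const_nhds hlim (fun _ => bot_le)
        (fun n => hele n)
    have hev : ∀ᶠ n : ℕ in atTop, e n < e m0 :=
      hlim2.eventually (gt_mem_nhds (pos_iff_ne_zero.2 hm0))
    obtain ⟨K, hK⟩ := eventually_atTop.1 hev
    obtain ⟨k, -, hk⟩ := Finset.exists_max_image (Finset.range (K + m0 + 1)) (fun n : ℕ => e n)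
      ⟨m0, by simp⟩
    have hm0k : e m0 ≤ e k := hk m0 (by simp)
    have hmax : ∀ j : ℤ, e j ≤ e k := by
      intro j
      rcases lt_or_ge j 0 with hj | hj
      · rw [he0 j hj.le]; exact bot_le
      · lift j to ℕ using hj
        rcases lt_or_ge j K with h | h
        · exact hk j (by simp; omega)
        · exact (hK j h).le.trans hm0k
    have hpos : e k ≠ 0 := fun h => hm0 (le_antisymm (hm0k.trans h.le) bot_le)
    have hstep : ∀ j : ℤ, e j = e k → e (j - 2) = e k := by
      intro j hj
      have hj1 : 1 ≤ j := by
        by_contra hh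
        exact hpos (by rw [← hj]; exact he0 j (by omega))
      by_contra hne
      have hlt : e (j - 2) < e k := lt_of_le_of_ne (hmax _) hne
      have hh := heh j hj1
      have hM : ∑' i, e k * N (i - j) = e k := by
        rw [ENNReal.tsum_mul_left]
        have : ∑' i, N (i - j) = 1 := by
          rw [← hN, ← (Equiv.subRight j).tsum_eq N]; rfl
        rw [this, mul_one]
      have hNt : N (-2) ≠ ⊤ := by
        refine ne_top_of_le_ne_top ENNReal.one_ne_top (?_ : _ ≤ (1 : ℝ≥0∞))
        rw [← hN]; exact ENNReal.le_tsum _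
      have hs : ∑' i, e i * N (i - j) < ∑' i, e k * N (i - j) := by
        refine ENNReal.tsum_lt_tsum (i := j - 2) ?_ (fun i => mul_le_mul_left (hmax i) _) ?_
        · change Pop N e j ≠ ⊤
          rw [hh]; exact hefin j
        · have : j - 2 - j = -2 := by ring
          rw [this]
          exact ENNReal.mul_lt_mul_left hN2 hNt hlt
      rw [hM] at hs
      change Pop N e j < _ at hs
      rw [hh, hj] at hs
      exact lt_irrefl _ hs
    have hall : ∀ n : ℕ, e ((k : ℤ) - 2 * n) = e k := by
      intro n
      induction n with
      | zero => simp
      | succ n ih =>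
        have := hstep _ ih
        rw [← this]; congr 1; push_cast; ring
    exact hpos (by rw [← hall k]; exact he0 _ (by omega))
  have haS : a = S := by
    funext k
    have : e k = 0 := by
      rcases lt_or_ge k 0 with hj | hj
      · exact he0 k hj.le
      · lift k to ℕ using hj
        exact hez k
    rw [← hSe k, this, add_zero]
  rw [haS]
  exact out_sup N hN

noncomputable def cb (n : ℕ) : ℝ := (Nat.choose (2 * n) n : ℝ) / 4 ^ n

lemma cb_zero : cb 0 = 1 := by simp [cb]

lemma cb_succ (n : ℕ) : 2 * ((n : ℝ) + 1) * cb (n + 1) = (2 * n + 1) * cb n := by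
  have h := Nat.succ_mul_centralBinom_succ n
  simp only [Nat.centralBinom_eq_two_mul_choose] at h
  have h' : ((n : ℝ) + 1) * (Nat.choose (2 * (n + 1)) (n + 1) : ℝ)
      = 2 * (2 * n + 1) * (Nat.choose (2 * n) n : ℝ) := by exact_mod_cast h
  unfold cb
  rw [pow_succ]
  field_simp
  linarith

lemma cb_nonneg (n : ℕ) : 0 ≤ cb n := by unfold cb; positivity

lemma cb_sq (n : ℕ) : cb n ^ 2 * (n + 1) ≤ 1 := by
  induction n with
  | zero => simp [cb_zero]
  | succ n ih =>
    have h : cb (n + 1) = (2 * n + 1) / (2 * (n + 1)) * cb n := by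
      have := cb_succ n
      field_simp
      linarith
    refine le_trans ?_ ih
    rw [h, mul_pow, mul_right_comm, mul_comm]
    refine mul_le_mul_of_nonneg_left ?_ (sq_nonneg _)
    rw [div_pow, div_mul_eq_mul_div, div_le_iff₀ (by positivity)]
    have : (0 : ℝ) ≤ n := Nat.cast_nonneg n
    push_cast
    nlinarith [mul_nonneg this this, mul_nonneg this (mul_nonneg this this)]

lemma tendsto_of_sq (f : ℕ → ℝ) (h : ∀ n : ℕ, f n ^ 2 * (n + 1) ≤ 1) :
    Tendsto f atTop (𝓝 0) := by
  have h2 : Tendsto (fun n => f n ^ 2) atTop (𝓝 0) := by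
    refine tendsto_of_tendsto_of_tendsto_of_le_of_le tendsto_const_nhds
      tendsto_one_div_add_atTop_nhds_zero_nat (fun n => sq_nonneg _) (fun n => ?_)
    rw [le_div_iff₀ (by positivity)]
    exact h n
  have h3 := h2.sqrt
  simp only [Real.sqrt_sq_eq_abs, Real.sqrt_zero] at h3
  exact (tendsto_zero_iff_abs_tendsto_zero _).2 h3

lemma cb_tendsto : Tendsto cb atTop (𝓝 0) := tendsto_of_sq cb cb_sq

lemma cb_le_one (n : ℕ) : cb n ≤ 1 := by
  have h := cb_sq n
  have h0 := cb_nonneg n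
  have : (0 : ℝ) ≤ n := Nat.cast_nonneg n
  nlinarith [mul_nonneg (sq_nonneg (cb n)) this]

lemma h0_nat (r : ℝ) (l : ℕ) :
    h0 r l = ∑ m ∈ Finset.range (l + 1), cb m * (cb (l - m) * (-r) ^ (l - m)) := by
  unfold h0
  rw [if_pos (by omega), Finset.mul_sum]
  refine Finset.sum_congr (by simp) fun m hm => ?_
  have hm' : m ≤ l := by simp at hm; omega
  simp only [Int.toNat_natCast, cb, zpow_neg, zpow_natCast]
  have : (4 : ℝ) ^ l = 4 ^ m * 4 ^ (l - m) := by rw [← pow_add]; congr 1; omega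
  rw [this]
  field_simp

lemma h0_tendsto_lt (r : ℝ) (hr : |r| < 1) : Tendsto (fun n : ℕ => h0 r n) atTop (𝓝 0) := by
  have key : ∀ l : ℕ, h0 r l = ∑' m : ℕ, if m ≤ l then cb (l - m) * (cb m * (-r) ^ m) else 0 := by
    intro l
    rw [h0_nat, ← Finset.sum_range_reflect, tsum_eq_sum (s := Finset.range (l + 1))]
    · refine Finset.sum_congr rfl fun m hm => ?_
      have hm' : m ≤ l := by simp at hm; omega
      rw [if_pos hm']
      have h1 : l + 1 - 1 - m = l - m := by omega
      have h2 : l - (l - m) = m := by omega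
      rw [h1, h2]
    · intro m hm
      rw [if_neg (by simp at hm; omega)]
  have : (0 : ℝ) = ∑' m : ℕ, (0 : ℝ) := by simp
  simp_rw [key]
  rw [this]
  refine tendsto_tsum_of_dominated_convergence (bound := fun m => |r| ^ m)
    (summable_geometric_of_lt_one (abs_nonneg r) hr) ?_ ?_
  · intro m
    have h1 : Tendsto (fun l : ℕ => cb (l - m) * (cb m * (-r) ^ m)) atTop (𝓝 0) := by
      have := (cb_tendsto.comp (tendsto_sub_atTop_nat m)).mul_const (cb m * (-r) ^ m)
      simpa using this
    refine h1.congr' ?_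
    filter_upwards [eventually_ge_atTop m] with l hl
    rw [if_pos hl]
  · refine Eventually.of_forall fun l m => ?_
    split_ifs
    · rw [norm_mul, norm_mul, norm_pow, norm_neg, Real.norm_eq_abs, Real.norm_eq_abs,
        Real.norm_eq_abs, abs_of_nonneg (cb_nonneg _), abs_of_nonneg (cb_nonneg _)]
      have hp : 0 ≤ |r| ^ m := by positivity
      calc cb (l - m) * (cb m * |r| ^ m) ≤ 1 * (1 * |r| ^ m) := by
            gcongr
            · exact mul_nonneg (cb_nonneg _) hp
            · exact cb_le_one _
            · exact cb_le_one _
        _ = |r| ^ m := by ring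
    · simp

open PowerSeries in
lemma h0_one_rec (n : ℕ) : ((n : ℝ) + 2) * h0 1 ((n + 2 : ℕ) : ℤ) = (n + 1) * h0 1 (n : ℤ)
    ∧ h0 1 ((1 : ℕ) : ℤ) = 0 := by
  let B : ℝ⟦X⟧ := PowerSeries.mk cb
  let D : ℝ⟦X⟧ := PowerSeries.mk fun m => cb m * (-1) ^ m
  have hB : 2 * d⁄dX ℝ B = 2 * (X * d⁄dX ℝ B) + B := by
    ext n
    rw [← map_ofNat (C (R := ℝ)) 2, map_add, coeff_C_mul, coeff_C_mul]
    rcases n with _ | n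
    · simp [B, coeff_derivative]
      have := cb_succ 0
      norm_num at this ⊢
      linarith
    · rw [coeff_succ_X_mul]
      simp only [B, coeff_derivative, coeff_mk]
      have := cb_succ (n + 1)
      push_cast at this ⊢
      linarith
  have hD : 2 * d⁄dX ℝ D = - (2 * (X * d⁄dX ℝ D)) - D := by
    ext n
    rw [← map_ofNat (C (R := ℝ)) 2, map_sub, map_neg, coeff_C_mul, coeff_C_mul]
    rcases n with _ | n
    · simp [D, coeff_derivative]
      have := cb_succ 0
      norm_num at this ⊢
      linarith
    · rw [coeff_succ_X_mul]
      simp only [D, coeff_derivative, coeff_mk]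
      have := cb_succ (n + 1)
      push_cast at this ⊢
      rw [pow_succ (-1 : ℝ) (n + 1)]
      linear_combination (-(-1 : ℝ) ^ (n + 1)) * this
  have hE : d⁄dX ℝ (B * D) = X * (X * d⁄dX ℝ (B * D)) + X * (B * D) := by
    have h2 : (2 : ℝ⟦X⟧) ≠ 0 := by
      intro h
      have := congrArg (coeff 0) h
      rw [← map_ofNat (C (R := ℝ)) 2] at this
      simp at this
    apply mul_left_cancel₀ h2
    rw [Derivation.leibniz]
    simp only [smul_eq_mul]
    linear_combination (1 + X) * D * hB + (1 - X) * B * hD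
  have hco : ∀ l : ℕ, coeff l (B * D) = h0 1 l := by
    intro l
    rw [coeff_mul, h0_nat, Finset.Nat.sum_antidiagonal_eq_sum_range_succ_mk]
    simp [B, D]
  constructor
  · have h := congrArg (coeff (n + 1)) hE
    rw [map_add, coeff_succ_X_mul, coeff_succ_X_mul, coeff_derivative, hco, hco] at h
    rcases n with _ | n
    · simp at h ⊢
      norm_num at h
      linarith
    · rw [coeff_succ_X_mul, coeff_derivative, hco] at h
      push_cast at h ⊢
      have e : (n : ℤ) + 1 + 1 + 1 = n + 1 + 2 := by ring
      rw [e] at h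
      linarith
  · have h := congrArg (coeff 0) hE
    rw [map_add, coeff_zero_X_mul, coeff_zero_X_mul, coeff_derivative, hco] at h
    simpa using h

lemma h0_one_sq (n : ℕ) : h0 1 (n : ℤ) ^ 2 * (n + 1) ≤ 1 := by
  induction n using Nat.twoStepInduction with
  | zero => rw [h0_nat]; simp [cb_zero]
  | one => rw [(h0_one_rec 0).2]; norm_num
  | more n ih _ =>
    have h := (h0_one_rec n).1
    have h' : h0 1 ((n + 2 : ℕ) : ℤ) = (n + 1) / (n + 2) * h0 1 (n : ℤ) := by
      field_simp
      linarith
    refine le_trans ?_ ih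
    rw [h', mul_pow, mul_right_comm, mul_comm]
    refine mul_le_mul_of_nonneg_left ?_ (sq_nonneg _)
    rw [div_pow, div_mul_eq_mul_div, div_le_iff₀ (by positivity)]
    have : (0 : ℝ) ≤ n := Nat.cast_nonneg n
    push_cast
    nlinarith [mul_nonneg this this, mul_nonneg this (mul_nonneg this this)]

lemma h0_tendsto (r : ℝ) (hr : r ∈ Set.Ioc (-1 : ℝ) 1) :
    Tendsto (fun n : ℕ => h0 r n) atTop (𝓝 0) := by
  rcases hr.2.lt_or_eq with h | h
  · exact h0_tendsto_lt r (abs_lt.2 ⟨hr.1, h⟩)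
  · rw [h]; exact tendsto_of_sq _ h0_one_sq

/-- the admissibility bound `∑_{l≥0} h_r^{(1)}(l+1) ν(l) ≤ 1`
(as a sum of nonnegative terms in `ℝ≥0∞`). -/
theorem stmt4 (r : ℝ) (hr : r ∈ Set.Ioc (-1 : ℝ) 1)
    (ν : ℤ → ℝ) (hprob : IsProbDist ν) (hν2 : 0 < ν (-2))
    (hharm : NuHarmonic ν (h0 r)) :
    ∑' l : ℕ, ENNReal.ofReal (h1 r ((l : ℤ) + 1) * ν (l : ℤ)) ≤ 1 := by
  obtain ⟨hν, hsum⟩ := hprob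
  obtain ⟨hnn, hh⟩ := hharm
  let a : ℤ → ℝ≥0∞ := fun k => ENNReal.ofReal (h0 r k)
  let N : ℤ → ℝ≥0∞ := fun k => ENNReal.ofReal (ν k)
  have hc := core a N
    (by
      change ∑' k, ENNReal.ofReal (ν k) = 1
      rw [← ENNReal.ofReal_tsum_of_nonneg hν hsum.summable, hsum.tsum_eq, ENNReal.ofReal_one])
    (by
      intro k hk
      have : h0 r k = 0 := by unfold h0; rw [if_neg (by omega)]
      simp [a, this])
    (by
      have := h0_nat r 0
      simp [cb_zero] at this
      simp [a, this])
    (fun k => ENNReal.ofReal_ne_top)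
    (by
      have := ENNReal.tendsto_ofReal (h0_tendsto r hr)
      rwa [ENNReal.ofReal_zero] at this)
    (by
      intro k hk
      have h := hh k hk
      change Pop N a k = ENNReal.ofReal (h0 r k)
      rw [← h.tsum_eq, ENNReal.ofReal_tsum_of_nonneg (fun l => mul_nonneg (hnn _) (hν _))
        h.summable]
      unfold Pop
      rw [← (Equiv.addLeft k).tsum_eq]
      refine tsum_congr fun l => ?_
      simp only [Equiv.coe_addLeft, a, N]
      rw [ENNReal.ofReal_mul (hnn _), add_sub_cancel_left])
    (by simpa [N] using hν2)
  refine le_trans ?_ hc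
  have h1 : ∀ l : ℕ, ENNReal.ofReal (h1 r ((l : ℤ) + 1) * ν (l : ℤ))
      ≤ ∑' k : ℕ, a ((l : ℤ) - k) * N l := by
    intro l
    rw [ENNReal.ofReal_mul' (hν _), ENNReal.tsum_mul_right]
    refine mul_le_mul_left ?_ _
    unfold _root_.h1
    rw [if_pos (by omega)]
    have : ((l : ℤ) + 1).toNat = l + 1 := by omega
    rw [this, ENNReal.ofReal_sum_of_nonneg (fun _ _ => hnn _), ← Finset.sum_range_reflect]
    refine le_trans (le_of_eq ?_) (ENNReal.sum_le_tsum (Finset.range (l + 1)))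
    refine Finset.sum_congr rfl fun m hm => ?_
    have hm' : m ≤ l := by simp at hm; omega
    have : ((l + 1 - 1 - m : ℕ) : ℤ) = l - m := by omega
    rw [this]
  refine (ENNReal.tsum_le_tsum h1).trans ?_
  rw [ENNReal.tsum_comm]
  refine ENNReal.tsum_le_tsum fun k => ?_
  unfold Pop
  rw [← (Equiv.subRight (k : ℤ)).tsum_eq]
  simp only [Equiv.subRight_apply, sub_neg_eq_add, sub_add_cancel]
  exact ENNReal.tsum_comp_le_tsum_of_injective Nat.cast_injective
    (fun l : ℤ => a (l - k) * N l)
end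

section
/- Suppose r ∈ (-1,1], ν is a probability distribution on ℤ such that h_r^{(0)} is ν-harmonic on ℤ_{>0} and ∑_{l=0}^∞ h_r^{(1)}(l+1)·ν(l) < ∞. Then the superharmonicity defect of h_r^{(1)} is constant: for every integer k ≥ 1, ∑_{l∈ℤ} h_r^{(1)}(l+k)·ν(l) - h_r^{(1)}(k) = ∑_{l=0}^∞ h_r^{(1)}(l+1)·ν(l) - h_r^{(1)}(1). -/
open scoped BigOperators

theorem h1_succ_aux (r : ℝ) (x : ℤ) : h1 r (x + 1) = h1 r x + h0 r x := by
  rcases lt_trichotomy x 0 with h | h | h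
  · have a1 : ¬ (1 ≤ x + 1) := by omega
    have a2 : ¬ (1 ≤ x) := by omega
    have a3 : ¬ (0 ≤ x) := by omega
    simp [h1, h0, a1, a2, a3]
  · subst h
    simp [h1]
  · obtain ⟨n, rfl⟩ := Int.eq_ofNat_of_zero_le h.le
    have a1 : (1 : ℤ) ≤ (n : ℤ) + 1 := by omega
    have a2 : (1 : ℤ) ≤ (n : ℤ) := by omega
    have a3 : ((n : ℤ) + 1).toNat = n + 1 := by omega
    rw [h1, h1, if_pos a1, if_pos a2, a3, Int.toNat_natCast, Finset.sum_range_succ]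

/-- the superharmonicity defect of `h_r^{(1)}` is constant in `k`. -/
theorem stmt8 (r : ℝ) (hr : r ∈ Set.Ioc (-1 : ℝ) 1)
    (ν : ℤ → ℝ) (hprob : IsProbDist ν)
    (hharm : NuHarmonic ν (h0 r))
    (hfin : Summable fun l : ℕ => h1 r ((l : ℤ) + 1) * ν (l : ℤ)) :
    ∀ k : ℤ, 1 ≤ k →
      Summable (fun l : ℤ => h1 r (l + k) * ν l) ∧
      (∑' l : ℤ, h1 r (l + k) * ν l) - h1 r k =
        (∑' l : ℕ, h1 r ((l : ℤ) + 1) * ν (l : ℤ)) - h1 r 1 := by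
  have key : ∀ k : ℤ, 1 ≤ k → HasSum (fun l : ℤ => h1 r (l + k) * ν l)
      ((∑' l : ℕ, h1 r ((l : ℤ) + 1) * ν (l : ℤ)) - h1 r 1 + h1 r k) := by
    intro k hk
    induction k, hk using Int.leInduction with
    | base =>
      rw [sub_add_cancel]
      have hinj : Function.Injective (fun n : ℕ => (n : ℤ)) := Nat.cast_injective
      refine (hinj.hasSum_iff ?_).1 hfin.hasSum
      intro x hx
      have hx' : ¬ (1 ≤ x + 1) := fun h => hx ⟨x.toNat, by simp; omega⟩
      simp [h1, hx']
    | succ k hk ih =>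
      have h := ih.add (hharm.2 k hk)
      rw [h1_succ_aux, ← add_assoc]
      convert h using 1
      funext l
      rw [← add_assoc, h1_succ_aux, add_comm k l, add_mul]
  intro k hk
  refine ⟨(key k hk).summable, ?_⟩
  rw [(key k hk).tsum_eq]
  ring
end

section
/- Suppose r ∈ (-1,1] and ν is a probability distribution on ℤ. If h_r^{(1)} is ν-harmonic on ℤ_{>0}, then h_r^{(0)} is ν-harmonic on ℤ_{>0}. -/
open scoped BigOperators

noncomputable def aux_a (n : ℕ) : ℝ := (Nat.centralBinom n : ℝ) / 4 ^ n

theorem aux_a_rec (n : ℕ) : 2 * ((n : ℝ) + 1) * aux_a (n + 1) = (2 * n + 1) * aux_a n := by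
  have h := Nat.succ_mul_centralBinom_succ n
  have h' : ((n : ℝ) + 1) * (Nat.centralBinom (n + 1) : ℝ) = 2 * (2 * n + 1) * Nat.centralBinom n := by
    exact_mod_cast h
  unfold aux_a
  rw [pow_succ]
  field_simp
  linear_combination 2 * h'

theorem aux_a_nonneg (n : ℕ) : 0 ≤ aux_a n := by unfold aux_a; positivity

noncomputable def aux_B (s : ℝ) : PowerSeries ℝ := PowerSeries.mk fun n => aux_a n * s ^ n

theorem aux_B_ode (s : ℝ) :
    2 * (PowerSeries.derivative ℝ (aux_B s)) - 2 * (PowerSeries.C s * (PowerSeries.X * PowerSeries.derivative ℝ (aux_B s)))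
      = PowerSeries.C s * aux_B s := by
  have h2 : (2 : PowerSeries ℝ) = PowerSeries.C (2 : ℝ) := (map_ofNat PowerSeries.C 2).symm
  rw [h2]
  ext n
  rcases n with _ | n
  · have h := aux_a_rec 0
    simp only [map_sub, PowerSeries.coeff_C_mul, PowerSeries.coeff_zero_X_mul, PowerSeries.coeff_derivative, aux_B, PowerSeries.coeff_mk]
    norm_num at h ⊢
    linear_combination s * h
  · have h := aux_a_rec (n + 1)
    simp only [map_sub, PowerSeries.coeff_C_mul, PowerSeries.coeff_succ_X_mul, PowerSeries.coeff_derivative, aux_B, PowerSeries.coeff_mk]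
    push_cast at h ⊢
    rw [pow_succ s (n+1)]
    linear_combination s * s ^ (n+1) * h

theorem aux_H_ode (r : ℝ) :
    2 * PowerSeries.derivative ℝ (aux_B 1 * aux_B (-r))
      = 2 * (PowerSeries.C (1 - r) * (PowerSeries.X * PowerSeries.derivative ℝ (aux_B 1 * aux_B (-r))))
      + 2 * (PowerSeries.C r * (PowerSeries.X * (PowerSeries.X * PowerSeries.derivative ℝ (aux_B 1 * aux_B (-r)))))
      + PowerSeries.C (1 - r) * (aux_B 1 * aux_B (-r))
      + 2 * (PowerSeries.C r * (PowerSeries.X * (aux_B 1 * aux_B (-r)))) := by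
  have h1 := aux_B_ode 1
  have h2 := aux_B_ode (-r)
  simp only [Derivation.leibniz, smul_eq_mul, map_sub, map_neg, map_one] at h1 h2 ⊢
  linear_combination (1 + PowerSeries.C r * PowerSeries.X) * aux_B (-r) * h1
    + (1 - PowerSeries.X) * aux_B 1 * h2

theorem aux_nonneg (r : ℝ) (h0 : 0 ≤ r) (h1 : r ≤ 1) (n : ℕ) :
    0 ≤ PowerSeries.coeff n (aux_B 1 * aux_B (-r)) ∧
    0 ≤ PowerSeries.coeff (n + 1) (aux_B 1 * aux_B (-r)) := by
  have ho := aux_H_ode r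
  have h2 : (2 : PowerSeries ℝ) = PowerSeries.C (2 : ℝ) := (map_ofNat PowerSeries.C 2).symm
  rw [h2] at ho
  have hz : PowerSeries.coeff 0 (aux_B 1 * aux_B (-r)) = 1 := by
    simp [aux_B, aux_a]
  generalize aux_B 1 * aux_B (-r) = H at ho hz ⊢
  induction n with
  | zero =>
    have := congrArg (PowerSeries.coeff 0) ho
    simp only [map_add, PowerSeries.coeff_C_mul, PowerSeries.coeff_zero_X_mul,
      PowerSeries.coeff_derivative, hz] at this
    rw [hz]
    norm_num at this ⊢
    linarith
  | succ n ih =>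
    refine ⟨ih.2, ?_⟩
    obtain ⟨i1, i2⟩ := ih
    have := congrArg (PowerSeries.coeff (n + 1)) ho
    have e : PowerSeries.coeff n (PowerSeries.X * PowerSeries.derivative ℝ H)
        = n * PowerSeries.coeff n H := by
      rcases n with _ | n
      · simp
      · rw [PowerSeries.coeff_succ_X_mul, PowerSeries.coeff_derivative]; push_cast; ring
    simp only [map_add, PowerSeries.coeff_C_mul, PowerSeries.coeff_succ_X_mul, e,
      PowerSeries.coeff_derivative] at this
    have k1 : 0 ≤ (1 - r) * PowerSeries.coeff (n + 1) H := mul_nonneg (by linarith) i2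
    have k2 : 0 ≤ r * PowerSeries.coeff n H := mul_nonneg h0 i1
    have k3 := mul_nonneg (Nat.cast_nonneg (α := ℝ) n) k1
    have k4 := mul_nonneg (Nat.cast_nonneg (α := ℝ) n) k2
    have hp : (0 : ℝ) < ((n + 1 : ℕ) : ℝ) + 1 := by positivity
    refine nonneg_of_mul_nonneg_left ?_ hp
    push_cast at this ⊢
    nlinarith

theorem aux_h0 (r : ℝ) (n : ℕ) : h0 r n = PowerSeries.coeff n (aux_B 1 * aux_B (-r)) := by
  rw [PowerSeries.coeff_mul, Finset.Nat.sum_antidiagonal_eq_sum_range_succ_mk, h0,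
    if_pos (by positivity), Finset.mul_sum]
  simp only [Int.toNat_natCast]
  refine Finset.sum_congr rfl fun m hm => ?_
  obtain ⟨k, rfl⟩ := Nat.exists_eq_add_of_le (Nat.lt_succ_iff.mp (Finset.mem_range.mp hm))
  simp only [aux_B, PowerSeries.coeff_mk, aux_a, Nat.centralBinom, Nat.add_sub_cancel_left,
    zpow_neg, zpow_natCast, one_pow, pow_add]
  field_simp

theorem aux_h0_nonneg (r : ℝ) (hr : r ∈ Set.Ioc (-1 : ℝ) 1) (l : ℤ) : 0 ≤ h0 r l := by
  rcases lt_or_ge l 0 with hl | hl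
  · rw [h0, if_neg (by omega)]
  · lift l to ℕ using hl
    rcases le_total 0 r with h | h
    · rw [aux_h0]; exact (aux_nonneg r h hr.2 l).1
    · have : 0 ≤ -r := by linarith
      rw [h0, if_pos (by positivity)]
      positivity

theorem aux_diff (r : ℝ) (l : ℤ) : h0 r l = h1 r (l + 1) - h1 r l := by
  rcases lt_or_ge l 0 with hl | hl
  · rw [h0, h1, h1, if_neg (by omega), if_neg (by omega), if_neg (by omega), sub_zero]
  · lift l to ℕ using hl
    have e : ∀ n : ℕ, h1 r (n : ℤ) = ∑ p ∈ Finset.range n, h0 r (p : ℤ) := by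
      intro n
      rcases n with _ | n
      · simp [h1]
      · rw [h1, if_pos (by push_cast; omega), Int.toNat_natCast]
    have := e (l + 1)
    push_cast at this
    rw [this, e, Finset.sum_range_succ]; ring

/-- `ν`-harmonicity of `h_r^{(1)}` implies `ν`-harmonicity of `h_r^{(0)}`. -/
theorem stmt9 (r : ℝ) (hr : r ∈ Set.Ioc (-1 : ℝ) 1)
    (ν : ℤ → ℝ) (hprob : IsProbDist ν)
    (hharm : NuHarmonic ν (h1 r)) :
    NuHarmonic ν (h0 r) := by
  refine ⟨aux_h0_nonneg r hr, fun k hk => ?_⟩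
  have a := (hharm.2 (k + 1) (by omega)).sub (hharm.2 k hk)
  rw [← aux_diff] at a
  refine (congrArg (fun f => HasSum f (h0 r k)) (funext fun l => ?_)).mpr a
  rw [aux_diff, show k + 1 + l = k + l + 1 by ring]; ring
end

section
/- Suppose r ∈ (-1,1] and ν is a probability distribution on ℤ such that h_r^{(1)} is ν-harmonic on ℤ_{>0} (ν is critical). Then the negative jump probabilities are expressed linearly in the positive ones: for every integer k ≥ 1, ν(-k) = ∑_{m=1}^∞ R_r(k,m)·ν(m). -/
open scoped BigOperators

open PowerSeries in
theorem aux_shift (f : ℤ → ℝ) (hf : f (-1) = 0) :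
    (X : ℝ⟦X⟧) * mk (fun n : ℕ => f n) = mk (fun n : ℕ => f ((n : ℤ) - 1)) := by
  ext n
  cases n with
  | zero => simp [hf]
  | succ n => simp [coeff_succ_X_mul]

noncomputable def auxB : PowerSeries ℝ :=
  PowerSeries.mk (fun n : ℕ => (Nat.choose (2 * n) n : ℝ) / 4 ^ n)

open PowerSeries in
theorem auxB_ode : 2 * (1 - X) * derivative ℝ auxB = auxB := by
  have h : ∀ n : ℕ, ((n : ℝ) + 1) * (Nat.choose (2 * (n + 1)) (n + 1) : ℝ)
      = 2 * (2 * n + 1) * (Nat.choose (2 * n) n : ℝ) := by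
    intro n
    have := Nat.succ_mul_centralBinom_succ n
    simp only [Nat.centralBinom] at this
    exact_mod_cast this
  have e : 2 * (1 - X) * derivative ℝ auxB
      = C (2 : ℝ) * (derivative ℝ auxB - X * derivative ℝ auxB) := by
    rw [show (C (2 : ℝ) : ℝ⟦X⟧) = 2 from map_ofNat _ 2]; ring
  rw [e]
  ext n
  rw [coeff_C_mul, map_sub]
  cases n with
  | zero =>
    simp [auxB, coeff_derivative]
    norm_num
  | succ n =>
    rw [coeff_succ_X_mul, coeff_derivative, coeff_derivative]
    simp only [auxB, coeff_mk]
    have h1 := h (n + 1)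
    push_cast at h1 ⊢
    rw [pow_succ (4 : ℝ) (n + 1)]
    field_simp
    linarith

open PowerSeries in
theorem auxB_sq : auxB ^ 2 * (1 - X) = 1 := by
  apply derivative.ext
  · have := auxB_ode
    simp only [Derivation.leibniz, map_sub, Derivation.leibniz_pow, smul_eq_mul, derivative_X,
      Derivation.map_one_eq_zero]
    simp only [nsmul_eq_mul]
    push_cast
    linear_combination auxB * this
  · simp [auxB]

theorem h0_neg (r : ℝ) (l : ℤ) (h : l < 0) : h0 r l = 0 := by
  simp [h0, not_le.mpr h]

theorem h1_nonpos (r : ℝ) (l : ℤ) (h : l ≤ 0) : h1 r l = 0 := by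
  rw [h1, if_neg (by omega)]

theorem h1_diff (r : ℝ) (n : ℕ) : h1 r ((n : ℤ) + 1) - h1 r n = h0 r n := by
  rw [h1, if_pos (by omega)]
  rw [show ((n : ℤ) + 1).toNat = n + 1 by omega, Finset.sum_range_succ]
  rw [h1]
  split_ifs with h
  · simp
  · have : n = 0 := by omega
    subst this
    simp

open PowerSeries in
theorem auxH0 (r : ℝ) : mk (fun n : ℕ => h0 r n) = auxB * rescale (-r) auxB := by
  ext n
  rw [coeff_mk, coeff_mul, Finset.Nat.sum_antidiagonal_eq_sum_range_succ_mk, h0,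
    if_pos (by omega), Finset.mul_sum]
  simp only [Int.toNat_natCast]
  apply Finset.sum_congr rfl
  intro m hm
  have hm' : m ≤ n := by simpa [Nat.lt_succ_iff] using hm
  simp only [auxB, coeff_rescale, coeff_mk]
  rw [zpow_neg, zpow_natCast]
  have : (4 : ℝ) ^ n = 4 ^ m * 4 ^ (n - m) := by rw [← pow_add]; congr 1; omega
  rw [this]
  field_simp

open PowerSeries in
theorem auxH0_sq (r : ℝ) :
    (mk (fun n : ℕ => h0 r n)) ^ 2 * ((1 - X) * (1 + C r * X)) = 1 := by
  have h2 := congrArg (rescale (-r)) auxB_sq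
  simp only [map_mul, map_sub, map_pow, map_one, rescale_X, map_neg] at h2
  rw [auxH0]
  linear_combination (rescale (-r) auxB ^ 2 * (1 + C r * X)) * auxB_sq + h2

noncomputable def auxg (r : ℝ) (n : ℤ) : ℝ := hm2 r (n - 2) + r * hm2 r (n - 3)

open PowerSeries in
theorem auxG (r : ℝ) : mk (fun n : ℕ => auxg r n)
    = (1 - X) ^ 2 * (1 + C r * X) * mk (fun n : ℕ => h0 r n) := by
  have a1 := aux_shift (h0 r) (h0_neg r _ (by norm_num))
  have a2 := aux_shift (fun n => h0 r (n - 1)) (h0_neg r _ (by norm_num))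
  have a3 := aux_shift (fun n => h0 r (n - 1 - 1)) (h0_neg r _ (by norm_num))
  have e : (mk (fun n : ℕ => auxg r n) : ℝ⟦X⟧) = mk (fun n : ℕ => h0 r n)
      + C (r - 2) * mk (fun n : ℕ => h0 r ((n : ℤ) - 1))
      + C (1 - 2 * r) * mk (fun n : ℕ => h0 r ((n : ℤ) - 1 - 1))
      + C r * mk (fun n : ℕ => h0 r ((n : ℤ) - 1 - 1 - 1)) := by
    ext n
    simp only [map_add, coeff_C_mul, coeff_mk, auxg, hm2, hm1]
    ring_nf
  rw [e, ← a3, ← a2, ← a1]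
  have : (C (2 : ℝ) : ℝ⟦X⟧) = 2 := map_ofNat _ 2
  simp only [map_sub, map_mul, map_one, this]
  ring

open PowerSeries in
theorem auxH1 (r : ℝ) : (1 - X : ℝ⟦X⟧) * mk (fun n : ℕ => h1 r ((n : ℤ) + 1))
    = mk (fun n : ℕ => h0 r n) := by
  have a1 := aux_shift (fun n => h1 r (n + 1)) (h1_nonpos r _ (by norm_num))
  rw [sub_mul, one_mul, a1]
  ext n
  simp only [map_sub, coeff_mk, sub_add_cancel]
  exact h1_diff r n

open PowerSeries in
theorem auxGH (r : ℝ) :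
    mk (fun n : ℕ => auxg r n) * mk (fun n : ℕ => h1 r ((n : ℤ) + 1)) = 1 := by
  have hne : (1 - X : ℝ⟦X⟧) ≠ 0 := by
    intro h
    have := congrArg (coeff 0) h
    simp at this
  apply mul_left_cancel₀ hne
  rw [auxG]
  linear_combination ((1 - X) ^ 2 * (1 + C r * X) * mk (fun n : ℕ => h0 r n)) * auxH1 r
    + (1 - X) * auxH0_sq r

theorem aux_conv (r : ℝ) (n : ℕ) :
    ∑ i ∈ Finset.range (n + 1), auxg r i * h1 r ((n : ℤ) + 1 - i) = if n = 0 then 1 else 0 := by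
  have h := congrArg (PowerSeries.coeff n) (auxGH r)
  rw [PowerSeries.coeff_mul, Finset.Nat.sum_antidiagonal_eq_sum_range_succ_mk,
    PowerSeries.coeff_one] at h
  rw [← h]
  apply Finset.sum_congr rfl
  intro i hi
  have hi' : i ≤ n := by simpa [Nat.lt_succ_iff] using hi
  simp only [PowerSeries.coeff_mk]
  congr 2
  push_cast [hi']
  ring

noncomputable def auxc (r : ℝ) (k : ℕ) (l : ℤ) : ℝ :=
  ∑ i ∈ Finset.range (k + 1), auxg r i * h1 r ((k : ℤ) + 1 - i + l)

theorem auxc_nonpos (r : ℝ) (k : ℕ) (j : ℕ) :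
    auxc r k (-(j : ℤ)) = if j = k then 1 else 0 := by
  rcases lt_or_ge k j with h | h
  · rw [if_neg (by omega)]
    apply Finset.sum_eq_zero
    intro i _
    rw [h1_nonpos r _ (by omega), mul_zero]
  · obtain ⟨n, rfl⟩ := Nat.exists_eq_add_of_le h
    have := aux_conv r n
    rw [show (if j = j + n then (1 : ℝ) else 0) = if n = 0 then 1 else 0 by
      congr 1; simp, ← this, auxc]
    symm
    apply Finset.sum_subset_zero_on_sdiff
    · intro i; simp only [Finset.mem_range]; omega
    · intro i hi
      simp only [Finset.mem_sdiff, Finset.mem_range] at hi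
      rw [h1_nonpos r _ (by omega), mul_zero]
    · intro i _
      congr 2
      push_cast
      ring

theorem auxc_pos (r : ℝ) (k m : ℕ) :
    auxc r k ((m : ℤ) + 1) = - kernelR r k ((m : ℤ) + 1) := by
  have h := aux_conv r (k + 1 + m)
  rw [if_neg (by omega), show k + 1 + m + 1 = (k + 1) + (m + 1) by ring,
    Finset.sum_range_add] at h
  rw [eq_neg_iff_add_eq_zero, ← h, auxc, kernelR]
  congr 1
  · apply Finset.sum_congr rfl
    intro i _
    congr 2
    push_cast
    ring
  · rw [show ((m : ℤ) + 1).toNat = m + 1 by omega]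
    apply Finset.sum_congr rfl
    intro p _
    rw [mul_comm, auxg]
    push_cast
    ring_nf

/-- negative jump probabilities from the positive ones, via the kernel `R_r`. -/
theorem stmt10 (r : ℝ) (hr : r ∈ Set.Ioc (-1 : ℝ) 1)
    (ν : ℤ → ℝ) (hprob : IsProbDist ν)
    (hcrit : NuHarmonic ν (h1 r)) :
    ∀ k : ℤ, 1 ≤ k →
      HasSum (fun m : ℕ => kernelR r k ((m : ℤ) + 1) * ν ((m : ℤ) + 1)) (ν (-k)) := by
  intro k' hk'
  obtain ⟨k, rfl⟩ := Int.eq_ofNat_of_zero_le (by omega : 0 ≤ k')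
  have hs : HasSum (fun l : ℤ => auxc r k l * ν l) 0 := by
    have h0 : ∑ i ∈ Finset.range (k + 1), auxg r i * h1 r ((k : ℤ) + 1 - i) = 0 := by
      rw [aux_conv, if_neg (by omega)]
    rw [← h0]
    have : (fun l : ℤ => auxc r k l * ν l) = fun l : ℤ => ∑ i ∈ Finset.range (k + 1),
        auxg r i * (h1 r ((k : ℤ) + 1 - i + l) * ν l) := by
      funext l
      rw [auxc, Finset.sum_mul]
      exact Finset.sum_congr rfl fun i _ => mul_assoc _ _ _
    rw [this]
    apply hasSum_sum
    intro i hi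
    have hi' := Finset.mem_range.mp hi
    exact (hcrit.2 _ (by omega)).mul_left _
  have h2 := (hasSum_ite_eq (-(k : ℤ)) (ν (-(k : ℤ)))).sub hs
  rw [sub_zero] at h2
  have hinj : Function.Injective (fun m : ℕ => (m : ℤ) + 1) := by
    intro a b h
    simpa using h
  rw [← hinj.hasSum_iff] at h2
  · refine (congrArg (fun f : ℕ → ℝ => HasSum f (ν (-(k : ℤ)))) ?_).mpr h2
    funext m
    simp only [Function.comp]
    rw [if_neg (by omega), auxc_pos]
    ring
  · intro l hl
    have hl0 : l ≤ 0 := by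
      by_contra hc
      exact hl ⟨(l - 1).toNat, by simp only []; omega⟩
    obtain ⟨j, hj⟩ := Int.eq_ofNat_of_zero_le (by omega : 0 ≤ -l)
    obtain rfl : l = -(j : ℤ) := by omega
    rw [auxc_nonpos]
    by_cases hjk : j = k
    · subst hjk; simp
    · rw [if_neg (by omega), if_neg hjk]; simp
end

section
/- In the bipartite case r = 1 the kernel R_1 has the closed form: for all integers k, m ≥ 1, R_1(2k,2m) = 4^{-m-k} · (m(2m+1))/((m+k)(2k-1)) · C(2k,k) · C(2m,m). -/
open scoped BigOperators

noncomputable def cc (n : ℕ) : ℝ := (Nat.centralBinom n : ℝ) / 4 ^ n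

lemma cb_rec (n : ℕ) : ((n : ℝ) + 1) * (Nat.centralBinom (n+1) : ℝ)
    = 2 * (2 * n + 1) * (Nat.centralBinom n : ℝ) := by
  exact_mod_cast Nat.succ_mul_centralBinom_succ n

lemma cc_rec (n : ℕ) : (2 * (n : ℝ) + 2) * cc (n+1) = (2 * n + 1) * cc n := by
  have h := cb_rec n
  unfold cc
  have h4 : (4:ℝ)^n ≠ 0 := by positivity
  rw [pow_succ]
  field_simp
  linear_combination 2 * h

lemma cc_succ (n : ℕ) : cc (n+1) = (2 * n + 1) / (2 * (n : ℝ) + 2) * cc n := by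
  have h := cc_rec n
  have : 2 * (n : ℝ) + 2 ≠ 0 := by positivity
  field_simp
  linear_combination h

noncomputable def ff : PowerSeries ℝ := PowerSeries.mk fun n => (Nat.centralBinom n : ℝ)
noncomputable def gg : PowerSeries ℝ :=
  PowerSeries.mk fun n => (Nat.centralBinom n : ℝ) * (-1) ^ n

open PowerSeries in
lemma ff_ode : derivative ℝ ff = 2 * ff + 4 * (X * derivative ℝ ff) := by
  ext n
  have e2 : (2 : PowerSeries ℝ) = C 2 := (map_ofNat C 2).symm
  have e4 : (4 : PowerSeries ℝ) = C 4 := (map_ofNat C 4).symm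
  rw [map_add, e2, e4, coeff_C_mul, coeff_C_mul]
  rcases n with _ | n
  · simp only [coeff_zero_X_mul, coeff_derivative, ff, coeff_mk]
    have := cb_rec 0
    push_cast at *
    linear_combination this
  · simp only [coeff_succ_X_mul, coeff_derivative, ff, coeff_mk]
    have := cb_rec (n+1)
    push_cast at *
    linear_combination this

open PowerSeries in
lemma gg_ode : derivative ℝ gg = - (2 * gg) - 4 * (X * derivative ℝ gg) := by
  ext n
  have e2 : (2 : PowerSeries ℝ) = C 2 := (map_ofNat C 2).symm
  have e4 : (4 : PowerSeries ℝ) = C 4 := (map_ofNat C 4).symm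
  rw [map_sub, map_neg, e2, e4, coeff_C_mul, coeff_C_mul]
  rcases n with _ | n
  · simp only [coeff_zero_X_mul, coeff_derivative, gg, coeff_mk]
    have := cb_rec 0
    push_cast at *
    linear_combination -this
  · simp only [coeff_succ_X_mul, coeff_derivative, gg, coeff_mk]
    have := cb_rec (n+1)
    push_cast at *
    linear_combination (-1)^(n+2) * this

open PowerSeries in
lemma pp_ode : derivative ℝ (ff * gg) =
    X * (16 * (ff * gg) + 16 * (X * derivative ℝ (ff * gg))) := by
  have h1 := ff_ode
  have h2 := gg_ode
  have h3 : derivative ℝ (ff * gg) = ff * derivative ℝ gg + gg * derivative ℝ ff := by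
    rw [Derivation.leibniz]; simp
  rw [h3]
  linear_combination (1 + 4 * X) * gg * h1 + (1 - 4 * X) * ff * h2

open PowerSeries in
lemma pp_one : coeff 1 (ff * gg) = 0 := by
  have h := congrArg (coeff 0) pp_ode
  rw [coeff_zero_X_mul, coeff_derivative] at h
  simpa using h

open PowerSeries in
lemma pp_rec (n : ℕ) : ((n : ℝ) + 2) * coeff (n+2) (ff * gg)
    = 16 * (n + 1) * coeff n (ff * gg) := by
  have h := congrArg (coeff (n+1)) pp_ode
  have e : (16 : PowerSeries ℝ) = C 16 := (map_ofNat C 16).symm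
  rw [coeff_succ_X_mul, coeff_derivative, map_add, e, coeff_C_mul, coeff_C_mul] at h
  rcases n with _ | n
  · rw [coeff_zero_X_mul] at h
    push_cast at *
    linear_combination h
  · rw [coeff_succ_X_mul, coeff_derivative] at h
    push_cast at *
    linear_combination h

open PowerSeries in
lemma pp_odd (n : ℕ) : coeff (2*n+1) (ff * gg) = 0 := by
  induction n with
  | zero => exact pp_one
  | succ n ih =>
    have h := pp_rec (2*n+1)
    rw [ih, mul_zero] at h
    have : ((2*n+1 : ℕ) : ℝ) + 2 ≠ 0 := by positivity
    exact (mul_eq_zero.mp h).resolve_left this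

open PowerSeries in
lemma pp_even (n : ℕ) : coeff (2*n) (ff * gg) = 16 ^ n * cc n := by
  induction n with
  | zero => simp [ff, gg, cc, coeff_mul]
  | succ n ih =>
    have h := pp_rec (2*n)
    rw [ih] at h
    have h2 := cc_rec n
    have : ((2*n : ℕ) : ℝ) + 2 ≠ 0 := by positivity
    apply mul_left_cancel₀ this
    rw [show 2 * (n+1) = 2*n+2 by ring, h]
    push_cast
    rw [pow_succ]
    linear_combination (-16 * 16^n) * h2

open PowerSeries in
lemma h0_coeff (n : ℕ) : h0 1 (n : ℤ) = coeff n (ff * gg) / 4 ^ n := by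
  unfold h0
  rw [if_pos (by positivity), Int.toNat_natCast, coeff_mul,
    Finset.Nat.sum_antidiagonal_eq_sum_range_succ_mk]
  simp only [ff, gg, coeff_mk, Nat.centralBinom]
  rw [zpow_neg, zpow_natCast, div_eq_inv_mul]
  congr 1
  apply Finset.sum_congr rfl
  intro i _
  ring

lemma h0_even (n : ℕ) : h0 1 (2 * (n : ℤ)) = cc n := by
  have := h0_coeff (2*n)
  rw [pp_even, pow_mul] at this
  push_cast at this
  rw [this]
  norm_num

lemma h0_odd (n : ℕ) : h0 1 (2 * (n : ℤ) + 1) = 0 := by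
  have := h0_coeff (2*n+1)
  rw [pp_odd] at this
  push_cast at this
  rw [this]
  norm_num

lemma sum_pair (f : ℕ → ℝ) (n : ℕ) :
    ∑ i ∈ Finset.range (2*n), f i = ∑ i ∈ Finset.range n, (f (2*i) + f (2*i+1)) := by
  induction n with
  | zero => simp
  | succ n ih =>
    rw [show 2*(n+1) = 2*n+1+1 by ring, Finset.sum_range_succ, Finset.sum_range_succ,
      Finset.sum_range_succ, ih]
    ring

lemma h1_sum_even (n : ℕ) : ∑ p ∈ Finset.range (2*n), h0 1 (p : ℤ) = 2 * n * cc n := by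
  rw [sum_pair]
  induction n with
  | zero => simp
  | succ n ih =>
    rw [Finset.sum_range_succ, ih]
    push_cast
    rw [h0_even, h0_odd]
    linear_combination - cc_rec n

lemma h1_even (n : ℕ) : h1 1 (2 * ((n : ℤ) + 1)) = 2 * (n + 1) * cc (n+1) := by
  have := h1_sum_even (n+1)
  unfold h1
  rw [if_pos (by omega), show (2 * ((n : ℤ) + 1)).toNat = 2*(n+1) by omega, this]
  push_cast; ring

lemma h1_odd (n : ℕ) : h1 1 (2 * (n : ℤ) + 1) = 2 * (n + 1) * cc (n+1) := by
  have := h1_sum_even (n+1)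
  rw [show 2*(n+1) = 2*n+1+1 by ring, Finset.sum_range_succ] at this
  push_cast at this
  rw [h0_odd, add_zero] at this
  unfold h1
  rw [if_pos (by omega), show (2 * (n : ℤ) + 1).toNat = 2*n+1 by omega, this]

/-- indices shifted: `k+1`, and `m - q = j+1`. -/
noncomputable def TT (k j : ℕ) : ℝ :=
  2 * ((j : ℝ) + 1) * cc (j+1) * (cc k - 2 * cc (k+1) + cc (k+2))

lemma TT_eq (k j : ℕ) : TT k j = 2 * ((j : ℝ) + 1) * cc (j+1) *
    (3 * cc (k+1) / ((2*k+1) * (2*k+4))) := by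
  unfold TT
  congr 1
  rw [cc_succ (k+1), cc_succ k]
  have : 2 * (k : ℝ) + 2 ≠ 0 := by positivity
  have : 2 * (k : ℝ) + 4 ≠ 0 := by positivity
  have : 2 * ((k : ℝ) + 1) + 2 ≠ 0 := by positivity
  have : 2 * (k : ℝ) + 1 ≠ 0 := by positivity
  push_cast
  field_simp
  ring

lemma TT_sum (m k : ℕ) : ∑ q ∈ Finset.range m, TT (k+q) (m-1-q)
    = cc (k+1) * cc m * (m * (2*m+1)) / ((m + k + 1) * (2 * k + 1)) := by
  induction m generalizing k with
  | zero => simp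
  | succ m ih =>
    rw [Finset.sum_range_succ']
    have : ∑ q ∈ Finset.range m, TT (k+(q+1)) (m+1-1-(q+1))
      = ∑ q ∈ Finset.range m, TT ((k+1)+q) (m-1-q) := by
      apply Finset.sum_congr rfl
      intro q _
      congr 1 <;> omega
    rw [this, ih, TT_eq]
    simp only [add_zero, Nat.add_sub_cancel, Nat.sub_zero]
    rw [cc_succ (k+1), cc_succ m]
    have : (m : ℝ) + k + 2 ≠ 0 := by positivity
    have : (m : ℝ) + (k + 1) + 1 ≠ 0 := by positivity
    have : (m : ℝ) + 1 + k + 1 ≠ 0 := by positivity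
    have : 2 * (m : ℝ) + 2 ≠ 0 := by positivity
    have : 2 * (k : ℝ) + 4 ≠ 0 := by positivity
    have : 2 * ((k : ℝ) + 1) + 2 ≠ 0 := by positivity
    have : 2 * ((k : ℝ) + 1) + 1 ≠ 0 := by positivity
    have : 2 * (k : ℝ) + 1 ≠ 0 := by positivity
    push_cast
    field_simp
    ring

/-- closed form of the kernel `R_1` in the bipartite case. -/
theorem stmt11 (k m : ℕ) (hk : 1 ≤ k) (hm : 1 ≤ m) :
    kernelR 1 (2 * (k : ℤ)) (2 * (m : ℤ)) =
      (4 : ℝ) ^ (-(m : ℤ) - (k : ℤ)) *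
        ((m : ℝ) * (2 * (m : ℝ) + 1)) / (((m : ℝ) + (k : ℝ)) * (2 * (k : ℝ) - 1)) *
        (Nat.choose (2 * k) k : ℝ) * (Nat.choose (2 * m) m : ℝ) := by
  obtain ⟨k, rfl⟩ : ∃ k', k = k' + 1 := ⟨k - 1, by omega⟩
  unfold kernelR
  rw [show (2 * (m : ℤ)).toNat = 2 * m by omega, sum_pair]
  have key := TT_sum m k
  have : ∀ q ∈ Finset.range m, (h1 1 (2 * (m : ℤ) - ((2*q : ℕ) : ℤ)) *
      (hm2 1 (2 * ((k + 1 : ℕ) : ℤ) + ((2*q : ℕ) : ℤ) - 1)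
        + 1 * hm2 1 (2 * ((k + 1 : ℕ) : ℤ) + ((2*q : ℕ) : ℤ) - 2)) +
      h1 1 (2 * (m : ℤ) - ((2*q+1 : ℕ) : ℤ)) *
      (hm2 1 (2 * ((k + 1 : ℕ) : ℤ) + ((2*q+1 : ℕ) : ℤ) - 1)
        + 1 * hm2 1 (2 * ((k + 1 : ℕ) : ℤ) + ((2*q+1 : ℕ) : ℤ) - 2))) = TT (k+q) (m-1-q) := by
    intro q hq
    rw [Finset.mem_range] at hq
    obtain ⟨j, rfl⟩ : ∃ j, m = q + j + 1 := ⟨m - 1 - q, by omega⟩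
    rw [show q + j + 1 - 1 - q = j by omega]
    have a1 := h1_even j
    have a2 := h1_odd j
    have b0 := h0_even (k+q)
    have b1 := h0_even (k+q+1)
    have b2 := h0_even (k+q+2)
    have d0 := h0_odd (k+q)
    have d1 := h0_odd (k+q+1)
    rw [show 2 * ((q + j + 1 : ℕ) : ℤ) - ((2*q : ℕ) : ℤ) = 2 * ((j : ℤ) + 1) by push_cast; ring,
      show 2 * ((q + j + 1 : ℕ) : ℤ) - ((2*q+1 : ℕ) : ℤ) = 2 * (j : ℤ) + 1 by push_cast; ring,
      a1, a2]
    unfold hm2 hm1 TT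
    push_cast at *
    ring_nf at b0 b1 b2 d0 d1 ⊢
    rw [b0, b1, b2]
    ring
  rw [Finset.sum_congr rfl this, key]
  unfold cc Nat.centralBinom
  rw [sub_eq_add_neg, zpow_add₀ (by norm_num), zpow_neg, zpow_neg, zpow_natCast, zpow_natCast]
  have : (m : ℝ) + k + 1 ≠ 0 := by positivity
  have : 2 * (k : ℝ) + 1 ≠ 0 := by positivity
  push_cast
  rw [show 2 * ((k : ℝ) + 1) - 1 = 2 * k + 1 by ring, ← add_assoc]
  field_simp
end

section
/- For every r ∈ (-1,1) and every fixed integer m ≥ 1, lim_{k→∞} R_r(k,m)/h_r^{(-2)}(k) = (1+r)·h_r^{(2)}(m+1). -/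
open scoped BigOperators

open Filter Topology

noncomputable def wC (n : ℕ) : ℝ := (Nat.centralBinom n : ℝ) / 4 ^ n

lemma wC_zero : wC 0 = 1 := by simp [wC]

lemma wC_succ (n : ℕ) : wC (n + 1) = wC n * ((2 * n + 1) / (2 * n + 2)) := by
  have h : ((n : ℝ) + 1) * (Nat.centralBinom (n + 1) : ℝ) = 2 * (2 * n + 1) * Nat.centralBinom n := by
    exact_mod_cast Nat.succ_mul_centralBinom_succ n
  have hn : (n : ℝ) + 1 ≠ 0 := by positivity
  have h2 : (Nat.centralBinom (n + 1) : ℝ) = 2 * (2 * n + 1) * Nat.centralBinom n / ((n : ℝ) + 1) := by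
    field_simp
    linarith
  unfold wC
  rw [h2, pow_succ]
  field_simp
  ring

lemma wC_pos (n : ℕ) : 0 < wC n := by
  unfold wC
  have := Nat.centralBinom_pos n
  positivity

lemma wC_succ_le (n : ℕ) : wC (n + 1) ≤ wC n := by
  rw [wC_succ]
  apply mul_le_of_le_one_right (wC_pos n).le
  rw [div_le_one (by positivity)]
  linarith

lemma wC_le_one (n : ℕ) : wC n ≤ 1 := by
  induction n with
  | zero => simp [wC_zero]
  | succ n ih => exact (wC_succ_le n).trans ih

lemma wC_mono (i j : ℕ) : ((i : ℝ) + 1) * wC i ≤ ((i : ℝ) + j + 1) * wC (i + j) := by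
  induction j with
  | zero => simp
  | succ j ih =>
    refine ih.trans ?_
    rw [← add_assoc, wC_succ]
    have h := wC_pos (i + j)
    have : ((i : ℝ) + j + 1) ≤ ((i : ℝ) + (j + 1 : ℕ) + 1) * ((2 * (i + j : ℕ) + 1) / (2 * (i + j : ℕ) + 2)) := by
      push_cast
      rw [← mul_div_assoc, le_div_iff₀ (by positivity)]
      have : (0 : ℝ) ≤ (i : ℝ) + j := by positivity
      nlinarith
    calc _ ≤ _ := mul_le_mul_of_nonneg_right this h.le
      _ = _ := by ring

lemma wC_bound (i j : ℕ) : wC i ≤ (1 + 2 * (j : ℝ)) * wC (i + j) := by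
  have h := wC_mono i j
  have hp := wC_pos (i + j)
  have hi : (0 : ℝ) ≤ i := by positivity
  have hj : (0 : ℝ) ≤ j := by positivity
  have h2 : ((i : ℝ) + j + 1) * wC (i + j) ≤ ((i : ℝ) + 1) * ((1 + 2 * (j : ℝ)) * wC (i + j)) := by
    rw [← mul_assoc]
    apply mul_le_mul_of_nonneg_right _ hp.le
    nlinarith [mul_nonneg hi hj]
  exact le_of_mul_le_mul_left (h.trans h2) (by positivity)

noncomputable def aC (n : ℕ) : ℝ := 3 * wC n / ((2 * n - 1) * (2 * n - 3))

lemma odd1 (n : ℕ) : (1 : ℝ) ≤ |2 * (n : ℝ) - 1| := by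
  have : (1 : ℤ) ≤ |2 * (n : ℤ) - 1| := by
    apply Int.one_le_abs
    omega
  exact_mod_cast this

lemma odd3 (n : ℕ) : (1 : ℝ) ≤ |2 * (n : ℝ) - 3| := by
  have : (1 : ℤ) ≤ |2 * (n : ℤ) - 3| := by
    apply Int.one_le_abs
    omega
  exact_mod_cast this

lemma ne1 (n : ℕ) : 2 * (n : ℝ) - 1 ≠ 0 := by
  intro h
  have := odd1 n
  rw [h] at this
  norm_num at this

lemma ne3 (n : ℕ) : 2 * (n : ℝ) - 3 ≠ 0 := by
  intro h
  have := odd3 n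
  rw [h] at this
  norm_num at this

lemma aC_ne (n : ℕ) : aC n ≠ 0 := by
  unfold aC
  have := (wC_pos n).ne'
  have := ne1 n
  have := ne3 n
  positivity

lemma shift_bound (x : ℝ) (j : ℕ) (h : 1 ≤ |x|) : |x + 2 * j| ≤ (1 + 2 * (j : ℝ)) * |x| := by
  have hj : (0 : ℝ) ≤ j := by positivity
  have := abs_add_le x (2 * (j : ℝ))
  rw [abs_of_nonneg (by positivity : (0 : ℝ) ≤ 2 * (j : ℝ))] at this
  nlinarith

lemma aC_bound (i j : ℕ) : |aC i| ≤ (1 + 2 * (j : ℝ)) ^ 3 * |aC (i + j)| := by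
  have e : ∀ n, |aC n| = 3 * wC n / (|2 * (n : ℝ) - 1| * |2 * (n : ℝ) - 3|) := by
    intro n
    have := wC_pos n
    rw [aC, abs_div, abs_mul, abs_mul, abs_of_pos this]
    norm_num
  rw [e, e]
  have h1 := shift_bound _ j (odd1 i)
  have h3 := shift_bound _ j (odd3 i)
  have e1 : 2 * ((i + j : ℕ) : ℝ) - 1 = 2 * (i : ℝ) - 1 + 2 * j := by push_cast; ring
  have e3 : 2 * ((i + j : ℕ) : ℝ) - 3 = 2 * (i : ℝ) - 3 + 2 * j := by push_cast; ring
  have p1 := odd1 i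
  have p3 := odd3 i
  have q1 := odd1 (i + j)
  have q3 := odd3 (i + j)
  rw [e1] at *
  rw [e3] at *
  have hw := wC_bound i j
  have hw0 := wC_pos i
  have hw1 := wC_pos (i + j)
  rw [← mul_div_assoc, div_le_div_iff₀ (by positivity) (by positivity)]
  calc 3 * wC i * (|2 * (i : ℝ) - 1 + 2 * j| * |2 * (i : ℝ) - 3 + 2 * j|)
      ≤ 3 * ((1 + 2 * (j : ℝ)) * wC (i + j)) * (((1 + 2 * (j : ℝ)) * |2 * (i : ℝ) - 1|) * ((1 + 2 * (j : ℝ)) * |2 * (i : ℝ) - 3|)) := by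
        gcongr
    _ = _ := by ring

lemma aC_zero : aC 0 = wC 0 := by
  simp [aC]

lemma aC_one : aC 1 = wC 1 - 2 * wC 0 := by
  rw [aC, wC_succ 0, wC_zero]
  norm_num

lemma aC_two (n : ℕ) : aC (n + 2) = wC (n + 2) - 2 * wC (n + 1) + wC n := by
  have h1 := ne1 (n + 2)
  have h3 := ne3 (n + 2)
  rw [aC, wC_succ (n + 1), wC_succ n]
  push_cast at *
  have : (2 * ((n : ℝ) + 2) - 1) = 2 * n + 3 := by ring
  rw [this] at *
  have : (2 * ((n : ℝ) + 2) - 3) = 2 * n + 1 := by ring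
  rw [this] at *
  field_simp
  ring

lemma aC_ratio1 : Tendsto (fun n : ℕ => aC n / aC (n + 1)) atTop (𝓝 1) := by
  have e : ∀ n : ℕ, aC n / aC (n + 1) = 1 + 5 / (2 * (n : ℝ) - 3) := by
    intro n
    have h1 := ne1 n
    have h3 := ne3 n
    have h2 := (wC_pos n).ne'
    rw [aC, aC, wC_succ]
    push_cast
    have : (2 * ((n : ℝ) + 1) - 1) = 2 * n + 1 := by ring
    rw [this] at *
    have : (2 * ((n : ℝ) + 1) - 3) = 2 * n - 1 := by ring
    rw [this] at *
    field_simp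
    ring
  simp_rw [e]
  have : Tendsto (fun n : ℕ => 5 / (2 * (n : ℝ) - 3)) atTop (𝓝 0) := by
    apply Tendsto.const_div_atTop
    apply tendsto_atTop_add_const_right
    exact Tendsto.const_mul_atTop (by norm_num) tendsto_natCast_atTop_atTop
  simpa using this.const_add 1

lemma ratio_shift {f : ℕ → ℝ} (hf : ∀ᶠ n in atTop, f n ≠ 0)
    (h : Tendsto (fun n : ℕ => f n / f (n + 1)) atTop (𝓝 1)) (j : ℕ) :
    Tendsto (fun n : ℕ => f n / f (n + j)) atTop (𝓝 1) := by
  induction j with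
  | zero =>
    refine Tendsto.congr' ?_ tendsto_const_nhds
    filter_upwards [hf] with n hn
    simp [hn]
  | succ j ih =>
    have h2 := (tendsto_add_atTop_iff_nat (f := fun n : ℕ => f n / f (n + 1)) j).2 h
    have h3 := ih.mul h2
    rw [mul_one] at h3
    refine h3.congr' ?_
    filter_upwards [(tendsto_add_atTop_nat j).eventually hf] with n hn
    rw [div_mul_div_cancel₀ hn]
    rfl

noncomputable def bC (r : ℝ) (n : ℕ) : ℝ := wC n * (-r) ^ n

lemma bC_abs (r : ℝ) (n : ℕ) : |bC r n| ≤ |r| ^ n := by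
  rw [bC, abs_mul, abs_pow, abs_neg, abs_of_pos (wC_pos n)]
  exact mul_le_of_le_one_left (by positivity) (wC_le_one n)

lemma bC_summable (r : ℝ) (hr : |r| < 1) : Summable (bC r) :=
  Summable.of_norm_bounded (summable_geometric_of_lt_one (abs_nonneg r) hr) (bC_abs r)

lemma bC_tsum_pos (r : ℝ) (hr : |r| < 1) : 0 < ∑' n, bC r n := by
  have hs := bC_summable r hr
  have he : Summable fun k => bC r (2 * k) := hs.comp_injective (fun a b h => by simpa using h)
  have ho : Summable fun k => bC r (2 * k + 1) := hs.comp_injective (fun a b h => by simpa using h)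
  rw [← tsum_even_add_odd he ho, ← he.tsum_add ho]
  have hr1 := (abs_lt.1 hr).2
  have key : ∀ k, bC r (2 * k) + bC r (2 * k + 1) = (r ^ 2) ^ k * (wC (2 * k) - r * wC (2 * k + 1)) := by
    intro k
    rw [bC, bC, pow_succ, pow_mul, neg_sq]
    ring
  have pos : ∀ k, 0 < wC (2 * k) - r * wC (2 * k + 1) := by
    intro k
    have h1 := wC_succ_le (2 * k)
    have h2 := wC_pos (2 * k + 1)
    nlinarith
  refine (he.add ho).tsum_pos (fun k => ?_) 0 ?_
  · show 0 ≤ bC r (2 * k) + bC r (2 * k + 1)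
    rw [key]
    exact mul_nonneg (by positivity) (pos k).le
  · show 0 < bC r (2 * 0) + bC r (2 * 0 + 1)
    rw [key]
    simpa using pos 0

noncomputable def cC (r : ℝ) (n : ℕ) : ℝ := ∑ j ∈ Finset.range (n + 1), bC r j * aC (n - j)

lemma bound_summable (r : ℝ) (hr : |r| < 1) :
    Summable (fun j : ℕ => |r| ^ j * (1 + 2 * (j : ℝ)) ^ 3) := by
  have h : ∀ k : ℕ, Summable (fun n : ℕ => (n : ℝ) ^ k * |r| ^ n) := fun k =>
    summable_pow_mul_geometric_of_norm_lt_one k (by simpa using hr)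
  have := (((h 0).add ((h 1).mul_left 6)).add ((h 2).mul_left 12)).add ((h 3).mul_left 8)
  refine this.congr (fun j => ?_)
  ring

lemma cC_lim (r : ℝ) (hr : |r| < 1) :
    Tendsto (fun n => cC r n / aC n) atTop (𝓝 (∑' n, bC r n)) := by
  have e : ∀ n, cC r n / aC n =
      ∑' j, (if j ∈ Finset.range (n + 1) then bC r j * (aC (n - j) / aC n) else 0) := by
    intro n
    rw [tsum_eq_sum (s := Finset.range (n + 1))]
    · rw [cC, Finset.sum_div]
      refine Finset.sum_congr rfl (fun j hj => ?_)
      rw [if_pos hj, mul_div_assoc]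
    · intro j hj
      rw [if_neg hj]
  simp_rw [e]
  refine tendsto_tsum_of_dominated_convergence (bound_summable r hr) ?_ ?_
  · intro j
    have h := ratio_shift (Eventually.of_forall aC_ne) aC_ratio1 j
    have h2 := h.const_mul (bC r j)
    rw [mul_one] at h2
    rw [← tendsto_add_atTop_iff_nat j]
    refine h2.congr (fun n => ?_)
    rw [if_pos (by simp), Nat.add_sub_cancel]
  · refine Eventually.of_forall (fun n j => ?_)
    split_ifs with hj
    · have hj' : j ≤ n := by simpa [Nat.lt_succ_iff] using hj
      have hb := aC_bound (n - j) j
      rw [Nat.sub_add_cancel hj'] at hb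
      rw [norm_mul, norm_div, Real.norm_eq_abs, Real.norm_eq_abs, Real.norm_eq_abs]
      refine mul_le_mul (bC_abs r j) ?_ (by positivity) (by positivity)
      rw [div_le_iff₀ (abs_pos.2 (aC_ne n))]
      exact hb
    · rw [norm_zero]
      positivity

lemma cC_ne (r : ℝ) (hr : |r| < 1) : ∀ᶠ n in atTop, cC r n ≠ 0 := by
  filter_upwards [(cC_lim r hr).eventually_ne (bC_tsum_pos r hr).ne'] with n hn h
  simp [h] at hn

lemma cC_ratio1 (r : ℝ) (hr : |r| < 1) :
    Tendsto (fun n : ℕ => cC r n / cC r (n + 1)) atTop (𝓝 1) := by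
  have hB := (bC_tsum_pos r hr).ne'
  have h := cC_lim r hr
  have h1 := (tendsto_add_atTop_iff_nat (f := fun n => cC r n / aC n) 1).2 h
  have h2 := (h.div h1 hB).mul aC_ratio1
  rw [div_self hB, one_mul] at h2
  refine h2.congr (fun n => ?_)
  have := aC_ne n
  have := aC_ne (n + 1)
  simp only [Pi.div_apply]
  by_cases hc : cC r (n + 1) = 0
  · simp [hc]
  · field_simp

lemma h0_eq_s12 (r : ℝ) (n : ℕ) : h0 r (n : ℤ) = ∑ j ∈ Finset.range (n + 1), bC r j * wC (n - j) := by
  rw [h0, if_pos (by positivity), Int.toNat_natCast, Finset.mul_sum,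
    ← Finset.sum_range_reflect (fun j => bC r j * wC (n - j))]
  refine Finset.sum_congr rfl (fun j hj => ?_)
  have hj' : j ≤ n := by simpa [Nat.lt_succ_iff] using hj
  have e1 : n + 1 - 1 - j = n - j := by omega
  have e2 : n - (n - j) = j := by omega
  rw [e1, e2, bC, wC, wC, Nat.centralBinom, Nat.centralBinom, zpow_neg, zpow_natCast]
  have : (4 : ℝ) ^ n = 4 ^ (n - j) * 4 ^ j := by rw [← pow_add]; congr 1; omega
  rw [this]
  field_simp

lemma hm2_eq_s12 (r : ℝ) (k : ℕ) : hm2 r (k : ℤ) = cC r (k + 2) := by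
  have e1 : (k : ℤ) + 1 + 1 = ((k + 2 : ℕ) : ℤ) := by push_cast; ring
  have e2 : (k : ℤ) + 1 = ((k + 1 : ℕ) : ℤ) := by push_cast; ring
  rw [hm2, hm1, hm1, e1, e2, h0_eq_s12, h0_eq_s12, h0_eq_s12, cC]
  rw [Finset.sum_range_succ _ (k + 2), Finset.sum_range_succ _ (k + 1),
    Finset.sum_range_succ _ (k + 1), Finset.sum_range_succ _ (k + 2), Finset.sum_range_succ _ (k + 1)]
  have s : ∑ j ∈ Finset.range (k + 1), bC r j * aC (k + 2 - j)
      = ∑ j ∈ Finset.range (k + 1), bC r j * wC (k + 2 - j)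
        - 2 * ∑ j ∈ Finset.range (k + 1), bC r j * wC (k + 1 - j)
        + ∑ j ∈ Finset.range (k + 1), bC r j * wC (k - j) := by
    rw [Finset.mul_sum, ← Finset.sum_sub_distrib, ← Finset.sum_add_distrib]
    refine Finset.sum_congr rfl (fun j hj => ?_)
    have hj' : j ≤ k := by simpa [Nat.lt_succ_iff] using hj
    obtain ⟨i, rfl⟩ := Nat.exists_eq_add_of_le hj'
    have e1 : j + i + 2 - j = i + 2 := by omega
    have e2 : j + i + 1 - j = i + 1 := by omega
    have e3 : j + i - j = i := by omega
    rw [e1, e2, e3, aC_two]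
    ring
  have e3 : k + 2 - (k + 1) = 1 := by omega
  rw [s, Nat.sub_self, Nat.sub_self, e3, aC_zero, aC_one]
  ring

lemma h2_eq_s12 (r : ℝ) (m : ℕ) (hm : 1 ≤ m) :
    h2 r ((m : ℤ) + 1) = ∑ p ∈ Finset.range m, h1 r ((m : ℤ) - (p : ℤ)) := by
  have e : ((m : ℤ) + 1).toNat - 1 = m := by omega
  rw [h2, if_pos (by omega), e]
  have : Finset.Icc 1 m = Finset.Ico 1 (m + 1) := by ext; simp
  rw [this, Finset.sum_Ico_eq_sum_range, Nat.add_sub_cancel,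
    ← Finset.sum_range_reflect (fun p : ℕ => h1 r ((1 + p : ℕ) : ℤ))]
  refine Finset.sum_congr rfl (fun j hj => ?_)
  have hj' := Finset.mem_range.1 hj
  congr 1
  omega

/-- asymptotics of the kernel `R_r(k,m)` as `k → ∞` for fixed `m`. -/
theorem stmt12 (r : ℝ) (hr : r ∈ Set.Ioo (-1 : ℝ) 1) (m : ℤ) (hm : 1 ≤ m) :
    Filter.Tendsto (fun k : ℕ => kernelR r (k : ℤ) m / hm2 r (k : ℤ))
      Filter.atTop (nhds ((1 + r) * h2 r (m + 1))) := by
  obtain ⟨m, rfl⟩ := Int.eq_ofNat_of_zero_le (by omega : 0 ≤ m)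
  have hr' : |r| < 1 := abs_lt.2 hr
  have hne := cC_ne r hr'
  have hra := cC_ratio1 r hr'
  have R : ∀ i j : ℕ, Tendsto (fun k : ℕ => cC r (k + i) / cC r (k + j)) atTop (𝓝 1) := by
    intro i j
    have h := (ratio_shift hne hra j).div (ratio_shift hne hra i) one_ne_zero
    rw [div_one] at h
    refine h.congr' ?_
    filter_upwards [hne] with k hk
    simp only [Pi.div_apply]
    rw [div_div_div_cancel_left' _ _ hk]
  rw [h2_eq_s12 r m (by omega), ← tendsto_add_atTop_iff_nat 2, Finset.mul_sum]
  have e : ∀ k : ℕ, kernelR r ((k + 2 : ℕ) : ℤ) m / hm2 r ((k + 2 : ℕ) : ℤ) =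
      ∑ p ∈ Finset.range m, h1 r ((m : ℤ) - (p : ℤ)) *
        (cC r (k + (p + 3)) / cC r (k + 4) + r * (cC r (k + (p + 2)) / cC r (k + 4))) := by
    intro k
    rw [kernelR, Finset.sum_div, Int.toNat_natCast]
    refine Finset.sum_congr rfl (fun p _ => ?_)
    have e1 : ((k + 2 : ℕ) : ℤ) + (p : ℤ) - 1 = ((k + (p + 1) : ℕ) : ℤ) := by push_cast; ring
    have e2 : ((k + 2 : ℕ) : ℤ) + (p : ℤ) - 2 = ((k + p : ℕ) : ℤ) := by push_cast; ring
    rw [e1, e2, hm2_eq_s12, hm2_eq_s12, hm2_eq_s12]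
    simp only [add_assoc]
    norm_num
    ring
  simp_rw [e]
  refine tendsto_finsetSum _ (fun p _ => ?_)
  have h := ((R (p + 3) 4).add ((R (p + 2) 4).const_mul r)).const_mul (h1 r ((m : ℤ) - (p : ℤ)))
  rw [mul_one, mul_comm] at h
  exact h
end

section
/- Suppose r ∈ (-1,1) and ν is a probability distribution on ℤ such that h_r^{(1)} is ν-harmonic on ℤ_{>0} and 𝓛_ν < ∞. Then the negative tail of ν satisfies lim_{k→∞} k^{5/2}·ν(-k) = 3·𝓛_ν·√(1+r)/(4√π). -/
open scoped BigOperators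

namespace Stmt13Aux

open Filter Topology PowerSeries

noncomputable def cc (n : ℕ) : ℝ := (Nat.choose (2 * n) n : ℝ) / 4 ^ n

noncomputable def dd (n : ℕ) : ℝ := - cc n / (2 * n - 1)

noncomputable def aa (n : ℕ) : ℝ := 3 * cc n / ((2 * n - 1) * (2 * n - 3))

lemma cc_zero : cc 0 = 1 := by simp [cc]

lemma cc_succ (n : ℕ) : cc (n + 1) * (2 * n + 2) = cc n * (2 * n + 1) := by
  have h := Nat.succ_mul_centralBinom_succ n
  have h' : ((n : ℝ) + 1) * (Nat.choose (2 * (n + 1)) (n + 1) : ℝ)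
      = 2 * (2 * n + 1) * (Nat.choose (2 * n) n : ℝ) := by
    have := congrArg (Nat.cast (R := ℝ)) h
    simpa [Nat.centralBinom] using this
  unfold cc
  rw [pow_succ]
  field_simp
  linear_combination 2 * h'

lemma cc_succ' (n : ℕ) : cc (n + 1) = cc n * (2 * n + 1) / (2 * n + 2) := by
  rw [eq_div_iff (by positivity)]; exact cc_succ n

lemma cc_nonneg (n : ℕ) : 0 ≤ cc n := by unfold cc; positivity

lemma cc_pos (n : ℕ) : 0 < cc n := by
  unfold cc
  have : 0 < Nat.choose (2 * n) n := Nat.centralBinom_pos n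
  positivity

lemma cc_le_one (n : ℕ) : cc n ≤ 1 := by
  induction n with
  | zero => simp [cc_zero]
  | succ n ih =>
    rw [cc_succ', div_le_one (by positivity)]
    have := cc_nonneg n
    have hn : (0 : ℝ) ≤ n := n.cast_nonneg
    nlinarith

lemma odd_ne (n : ℕ) : (2 * n - 1 : ℝ) ≠ 0 := by
  intro h
  have : (2 * (n : ℤ) - 1 : ℤ) = 0 := by exact_mod_cast h
  omega

lemma odd_ne3 (n : ℕ) : (2 * n - 3 : ℝ) ≠ 0 := by
  intro h
  have : (2 * (n : ℤ) - 3 : ℤ) = 0 := by exact_mod_cast h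
  omega

lemma dd_abs_le (n : ℕ) : |dd n| ≤ 1 := by
  unfold dd
  rw [abs_div, abs_neg, abs_of_nonneg (cc_nonneg n), div_le_one (abs_pos.2 (odd_ne n))]
  refine (cc_le_one n).trans ?_
  have : (1 : ℤ) ≤ |2 * (n : ℤ) - 1| := Int.one_le_abs (by omega)
  exact_mod_cast this

lemma dd_succ (n : ℕ) : dd (n + 1) = cc (n + 1) - cc n := by
  unfold dd
  rw [cc_succ']
  push_cast
  have : (2 * (n + 1) - 1 : ℝ) ≠ 0 := by have := odd_ne (n+1); push_cast at this; exact this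
  have : (2 * n + 1 : ℝ) ≠ 0 := by positivity
  have : (2 * (n + 1) - 1 : ℝ) = 2 * n + 1 := by ring
  rw [this]
  field_simp
  ring

lemma aa_succ (n : ℕ) : aa (n + 1) = dd (n + 1) - dd n := by
  unfold aa dd
  rw [cc_succ']
  push_cast
  have h1 : (2 * (n + 1) - 1 : ℝ) = 2 * n + 1 := by ring
  have h2 : (2 * (n + 1) - 3 : ℝ) = 2 * n - 1 := by ring
  have : (2 * n + 1 : ℝ) ≠ 0 := by positivity
  have := odd_ne n
  rw [h1, h2]
  field_simp
  ring

noncomputable def C : PowerSeries ℝ := PowerSeries.mk cc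
noncomputable def D : PowerSeries ℝ := PowerSeries.mk dd
noncomputable def A : PowerSeries ℝ := PowerSeries.mk aa

lemma D_eq : D = (1 - X) * C := by
  ext n
  rcases n with _ | n
  · simp [D, C, dd, cc_zero]
  · rw [sub_mul, one_mul, map_sub, coeff_succ_X_mul]
    simp [D, C, dd_succ]

lemma A_eq : A = (1 - X) * D := by
  ext n
  rcases n with _ | n
  · simp [D, A, dd, aa, cc_zero]
  · rw [sub_mul, one_mul, map_sub, coeff_succ_X_mul]
    simp [D, A, aa_succ]

lemma C_ode : 2 * (1 - X) * derivative ℝ C = C := by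
  ext n
  have h2 : (2 : PowerSeries ℝ) = PowerSeries.C 2 := (map_ofNat PowerSeries.C 2).symm
  rw [mul_assoc, h2, coeff_C_mul]
  rcases n with _ | n
  · have := cc_succ 0
    have h3 := coeff_derivative C 0
    simp [C, sub_mul] at this h3 ⊢
    linarith
  · rw [sub_mul, one_mul, map_sub, coeff_succ_X_mul, coeff_derivative, coeff_derivative]
    have := cc_succ (n+1)
    simp only [C, coeff_mk]
    push_cast at this ⊢
    linarith

lemma C_sq : C * C * (1 - X) = 1 := by
  apply derivative.ext
  · have h := C_ode
    simp only [Derivation.leibniz, smul_eq_mul, map_sub, derivative_X, derivative_one]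
    simp
    linear_combination C * h
  · simp [C, cc_zero]

variable (r : ℝ)

noncomputable def Cr : PowerSeries ℝ := rescale (-r) C
noncomputable def Dr : PowerSeries ℝ := rescale (-r) D
noncomputable def u (n : ℕ) : ℝ := h1 r (n : ℤ)
noncomputable def H0 : PowerSeries ℝ := PowerSeries.mk (fun n => h0 r (n : ℤ))
noncomputable def H1 : PowerSeries ℝ := PowerSeries.mk (u r)
noncomputable def G : PowerSeries ℝ := A * Dr r
noncomputable def g (n : ℕ) : ℝ := coeff n (G r)

lemma rescale_lin : rescale (-r) (1 - X : PowerSeries ℝ) = 1 + PowerSeries.C r * X := by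
  ext n
  rw [coeff_rescale]
  rcases n with _ | n
  · simp
  · rw [map_sub, map_add, coeff_succ_mul_X, coeff_C, coeff_X]
    rcases n with _ | n <;> simp [coeff_one]

lemma Cr_sq : Cr r * Cr r * (1 + PowerSeries.C r * X) = 1 := by
  rw [← rescale_lin, Cr, ← map_mul, ← map_mul, C_sq, map_one]

lemma Dr_eq : Dr r = (1 + PowerSeries.C r * X) * Cr r := by
  rw [← rescale_lin, Cr, Dr, D_eq, map_mul]

lemma H0_eq : H0 r = C * Cr r := by
  ext n
  rw [coeff_mul, Finset.Nat.sum_antidiagonal_eq_sum_range_succ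
    (fun i j => coeff i C * coeff j (Cr r))]
  simp only [H0, coeff_mk, h0, C, Cr, coeff_rescale]
  rw [if_pos (by positivity), Finset.mul_sum]
  simp only [Int.toNat_natCast]
  refine Finset.sum_congr rfl fun m hm => ?_
  have hm' : m ≤ n := by simpa [Nat.lt_succ_iff] using hm
  unfold cc
  rw [zpow_neg, zpow_natCast]
  have : (4 : ℝ) ^ n = 4 ^ m * 4 ^ (n - m) := by rw [← pow_add]; congr 1; omega
  rw [this]
  field_simp

lemma u_zero : u r 0 = 0 := by simp [u, h1]

lemma u_succ (n : ℕ) : u r (n + 1) = u r n + h0 r n := by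
  have key : ∀ n : ℕ, u r n = ∑ p ∈ Finset.range n, h0 r (p : ℤ) := by
    intro n
    rcases n with _ | n
    · simp [u_zero]
    · unfold u h1
      rw [if_pos (by push_cast; omega), Int.toNat_natCast]
  rw [key, key, Finset.sum_range_succ]

lemma H1_eq : H1 r * (1 - X) = X * H0 r := by
  ext n
  rcases n with _ | n
  · simp [H1, u_zero]
  · rw [mul_sub, mul_one, map_sub, coeff_succ_X_mul, coeff_succ_mul_X]
    simp [H1, H0, u_succ]

lemma G_mul_H1 : G r * H1 r = X := by
  have e1 := C_sq
  have e2 := Cr_sq r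
  have e3 := H1_eq r
  rw [H0_eq] at e3
  rw [G, A_eq, D_eq, Dr_eq]
  calc (1 - X) * ((1 - X) * C) * ((1 + PowerSeries.C r * X) * Cr r) * H1 r
      = (1 - X) * C * ((1 + PowerSeries.C r * X) * Cr r) * (H1 r * (1 - X)) := by ring
    _ = (C * C * (1 - X)) * (Cr r * Cr r * (1 + PowerSeries.C r * X)) * X := by rw [e3]; ring
    _ = X := by rw [e1, e2]; ring

lemma h2_eq (m : ℕ) : h2 r ((m : ℤ) + 1) = ∑ i ∈ Finset.range (m + 1), u r i := by
  unfold h2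
  rcases m with _ | m
  · simp [u_zero]
  · rw [if_pos (by push_cast; omega)]
    have : (((m + 1 : ℕ) : ℤ) + 1).toNat - 1 = m + 1 := by omega
    rw [this, Finset.sum_range_succ' (u r), u_zero, add_zero]
    have hI : Finset.Icc 1 (m + 1) = Finset.Ico 1 (m + 2) := by
      ext x; simp only [Finset.mem_Icc, Finset.mem_Ico]; omega
    rw [hI, Finset.sum_Ico_eq_sum_range]
    simp [u, add_comm]

lemma choose_half (n : ℕ) : Ring.choose (1/2 : ℝ) n = (-1) ^ n * dd n := by
  induction n with
  | zero => simp [dd, cc_zero]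
  | succ n ih =>
    have h := Ring.choose_smul_choose (1/2 : ℝ) (Nat.le_succ n)
    have h1 : n.succ - n = 1 := by omega
    rw [h1, Ring.choose_one_right, ih] at h
    simp only [Nat.succ_eq_add_one, Nat.choose_succ_self_right, nsmul_eq_mul] at h
    have hpos : ((n : ℝ) + 1) ≠ 0 := by positivity
    push_cast at h
    apply mul_left_cancel₀ hpos
    rw [h, pow_succ]
    unfold dd
    rw [cc_succ']
    push_cast
    have h1 : (2 * (n + 1) - 1 : ℝ) = 2 * n + 1 := by ring
    have : (2 * n + 1 : ℝ) ≠ 0 := by positivity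
    have := odd_ne n
    rw [h1]
    field_simp
    ring

lemma hasSum_b (hr : r ∈ Set.Ioo (-1 : ℝ) 1) :
    HasSum (fun j => (-r) ^ j * dd j) (Real.sqrt (1 + r)) := by
  have h := (Real.one_add_rpow_hasFPowerSeriesOnBall_zero (a := 1/2)).hasSum (y := r) (by
    rw [← ENNReal.ofReal_one, Metric.eball_ofReal]
    simpa [abs_lt] using hr)
  simp only [binomialSeries_apply, zero_add, ← Real.sqrt_eq_rpow] at h
  refine h.congr_fun ?_
  intro j
  rw [choose_half, neg_pow]
  simp
  ring

noncomputable def w (n : ℕ) : ℝ := ((n : ℝ) + 1) ^ ((5 : ℝ) / 2)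

lemma w_pos (n : ℕ) : 0 < w n := by unfold w; positivity

lemma tendsto_lin_ratio (p q : ℝ) :
    Tendsto (fun n : ℕ => ((n : ℝ) + p) / ((n : ℝ) + q)) atTop (𝓝 1) := by
  have h1 : Tendsto (fun n : ℕ => p / (n : ℝ)) atTop (𝓝 0) :=
    tendsto_const_div_atTop_nhds_zero_nat p
  have h2 : Tendsto (fun n : ℕ => q / (n : ℝ)) atTop (𝓝 0) :=
    tendsto_const_div_atTop_nhds_zero_nat q
  have h := (h1.const_add 1).div (h2.const_add 1) (by norm_num)
  simp only [add_zero, div_one] at h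
  refine h.congr' ?_
  filter_upwards [eventually_gt_atTop 0] with n hn
  have hn' : (n : ℝ) ≠ 0 := by positivity
  simp only [Pi.div_apply]
  have e1 : 1 + p / (n : ℝ) = (n + p) / n := by field_simp
  have e2 : 1 + q / (n : ℝ) = (n + q) / n := by field_simp
  rw [e1, e2, div_div_div_cancel_right₀ hn']

lemma tendsto_rpow_ratio (p q : ℝ) (hp : 0 ≤ p) (hq : 0 ≤ q) :
    Tendsto (fun n : ℕ => ((n : ℝ) + p) ^ ((5 : ℝ) / 2) / ((n : ℝ) + q) ^ ((5 : ℝ) / 2))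
      atTop (𝓝 1) := by
  have h := (tendsto_lin_ratio p q).rpow_const (p := (5 : ℝ) / 2) (Or.inl one_ne_zero)
  rw [Real.one_rpow] at h
  refine h.congr fun n => ?_
  rw [Real.div_rpow (by positivity) (by positivity)]

lemma W_eq (n : ℕ) : Real.Wallis.W n = 1 / (cc n ^ 2 * (2 * n + 1)) := by
  rw [Real.Wallis.W_eq_factorial_ratio]
  have h : (Nat.choose (2 * n) n : ℝ) * (n.factorial * n.factorial) = (2 * n).factorial := by
    have := Nat.choose_mul_factorial_mul_factorial (show n ≤ 2 * n by omega)
    rw [show 2 * n - n = n by omega] at this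
    rw [← mul_assoc]
    exact_mod_cast this
  have hc : (Nat.choose (2 * n) n : ℝ) ≠ 0 := by
    exact_mod_cast (Nat.centralBinom_pos n).ne'
  have hf : (n.factorial : ℝ) ≠ 0 := by exact_mod_cast n.factorial_ne_zero
  have h4 : (2 : ℝ) ^ (4 * n) = (4 ^ n) ^ 2 := by
    rw [← pow_mul, show (4 : ℝ) = 2 ^ 2 by norm_num, ← pow_mul]; congr 1; ring
  rw [← h, cc, h4]
  have : (2 * n + 1 : ℝ) ≠ 0 := by positivity
  field_simp

lemma tendsto_sqrt_cc :
    Tendsto (fun n : ℕ => Real.sqrt (n + 1) * cc n) atTop (𝓝 (1 / Real.sqrt Real.pi)) := by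
  have hW := Real.Wallis.tendsto_W_nhds_pi_div_two.inv₀ (by positivity)
  have h := (hW.mul (tendsto_lin_ratio 1 (1/2))).mul_const (1/2)
  have h' := (Real.continuous_sqrt.tendsto _).comp h
  have e : Real.sqrt ((Real.pi / 2)⁻¹ * 1 * (1/2)) = 1 / Real.sqrt Real.pi := by
    rw [← Real.sqrt_one, ← Real.sqrt_div zero_le_one, Real.sqrt_one]
    congr 1
    field_simp
  rw [e] at h'
  refine h'.congr fun n => ?_
  simp only [Function.comp]
  rw [← Real.sqrt_sq (cc_nonneg n), ← Real.sqrt_mul (by positivity), W_eq]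
  congr 1
  field_simp

lemma tendsto_w_aa :
    Tendsto (fun n => w n * aa n) atTop (𝓝 (3 / (4 * Real.sqrt Real.pi))) := by
  have h := ((tendsto_sqrt_cc.mul (tendsto_lin_ratio 1 (-1/2))).mul
    (tendsto_lin_ratio 1 (-3/2))).mul_const (3/4)
  have e : 1 / Real.sqrt Real.pi * 1 * 1 * (3/4) = 3 / (4 * Real.sqrt Real.pi) := by ring
  rw [e] at h
  refine h.congr fun n => ?_
  have hw : w n = Real.sqrt (n + 1) * ((n : ℝ) + 1) ^ 2 := by
    unfold w
    rw [Real.sqrt_eq_rpow, ← Real.rpow_natCast, ← Real.rpow_add (by positivity)]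
    norm_num
  rw [hw, aa]
  have h1 := odd_ne n
  have h3 := odd_ne3 n
  have h1' : (n : ℝ) + (-1/2) = (2 * n - 1) / 2 := by ring
  have h3' : (n : ℝ) + (-3/2) = (2 * n - 3) / 2 := by ring
  rw [h1', h3']
  field_simp
  ring

lemma bdd_of_tendsto {f : ℕ → ℝ} {l : ℝ} (h : Tendsto f atTop (𝓝 l)) :
    ∃ M, 0 ≤ M ∧ ∀ n, |f n| ≤ M := by
  obtain ⟨M, hM⟩ := (Metric.isBounded_range_of_tendsto f h).exists_norm_le
  have hM' : ∀ n, |f n| ≤ M := fun n => hM _ ⟨n, rfl⟩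
  exact ⟨M, (abs_nonneg _).trans (hM' 0), hM'⟩

lemma g_eq (n : ℕ) : g r n = ∑ j ∈ Finset.range (n + 1), aa (n - j) * ((-r) ^ j * dd j) := by
  rw [g, G, mul_comm, coeff_mul, Finset.Nat.sum_antidiagonal_eq_sum_range_succ
    (fun i j => coeff i (Dr r) * coeff j A)]
  refine Finset.sum_congr rfl fun j _ => ?_
  simp [Dr, D, A, coeff_rescale]
  ring

lemma w_le (n j : ℕ) (h : j ≤ n) : w n ≤ w (n - j) * w j := by
  unfold w
  rw [← Real.mul_rpow (by positivity) (by positivity)]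
  apply Real.rpow_le_rpow (by positivity) _ (by norm_num)
  obtain ⟨k, rfl⟩ := Nat.exists_eq_add_of_le h
  rw [Nat.add_sub_cancel_left]
  push_cast
  have : (0 : ℝ) ≤ k * j := by positivity
  nlinarith

lemma tendsto_w_g (hr : r ∈ Set.Ioo (-1 : ℝ) 1) :
    Tendsto (fun n => w n * g r n) atTop
      (𝓝 (3 / (4 * Real.sqrt Real.pi) * Real.sqrt (1 + r))) := by
  obtain ⟨M, hM0, hM⟩ := bdd_of_tendsto tendsto_w_aa
  have hrabs : |r| < 1 := abs_lt.2 hr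
  have hsum := (hasSum_b r hr).mul_left (3 / (4 * Real.sqrt Real.pi))
  rw [← hsum.tsum_eq]
  have hb : Summable (fun j : ℕ => M * (w j * |r| ^ j)) := by
    apply Summable.mul_left
    have hs : Summable (fun j : ℕ => (8 * (((j : ℝ)) ^ 3 * |r| ^ j)) + 8 * |r| ^ j) := by
      refine Summable.add (Summable.mul_left _ ?_) (Summable.mul_left _ ?_)
      · exact summable_pow_mul_geometric_of_norm_lt_one 3 (by simpa using hrabs)
      · exact summable_geometric_of_lt_one (abs_nonneg _) hrabs
    refine Summable.of_nonneg_of_le (fun j => mul_nonneg (w_pos j).le (by positivity)) ?_ hs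
    intro j
    have hwj : w j ≤ 8 * (j : ℝ) ^ 3 + 8 := by
      calc w j ≤ ((j : ℝ) + 1) ^ ((3 : ℕ) : ℝ) := by
            unfold w
            apply Real.rpow_le_rpow_of_exponent_le
            · have : (0 : ℝ) ≤ j := j.cast_nonneg
              linarith
            · norm_num
        _ = ((j : ℝ) + 1) ^ 3 := Real.rpow_natCast _ _
        _ ≤ _ := by
            have hj : (0 : ℝ) ≤ j := j.cast_nonneg
            nlinarith [mul_nonneg hj (sq_nonneg ((j : ℝ) - 1)), sq_nonneg ((j : ℝ) - 1)]
    have := mul_le_mul_of_nonneg_right hwj (pow_nonneg (abs_nonneg r) j)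
    linarith
  have key := tendsto_tsum_of_dominated_convergence (𝓕 := atTop)
    (f := fun n j : ℕ => if j ≤ n then w n * aa (n - j) * ((-r) ^ j * dd j) else 0)
    (g := fun j => 3 / (4 * Real.sqrt Real.pi) * ((-r) ^ j * dd j)) hb ?_ ?_
  · refine key.congr fun n => ?_
    rw [tsum_eq_sum (s := Finset.range (n + 1))]
    · rw [g_eq, Finset.mul_sum]
      refine Finset.sum_congr rfl fun j hj => ?_
      rw [if_pos (by simpa [Nat.lt_succ_iff] using hj)]
      ring
    · intro j hj
      rw [if_neg]
      simpa [Nat.lt_succ_iff] using hj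
  · intro j
    rw [← tendsto_add_atTop_iff_nat j]
    have h1 := (tendsto_rpow_ratio (j + 1) 1 (by positivity) zero_le_one).mul tendsto_w_aa
    have h2 := h1.mul_const ((-r) ^ j * dd j)
    rw [one_mul] at h2
    refine h2.congr fun n => ?_
    rw [if_pos (by omega), Nat.add_sub_cancel]
    congr 1
    have := (w_pos n).ne'
    unfold w at *
    field_simp
    push_cast
    ring_nf
  · refine Eventually.of_forall fun n j => ?_
    split_ifs with h
    · rw [Real.norm_eq_abs, abs_mul, abs_mul, abs_mul, abs_pow, abs_neg, abs_of_pos (w_pos n)]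
      have h1 := w_le n j h
      have h2 := hM (n - j)
      rw [abs_mul, abs_of_pos (w_pos _)] at h2
      have h3 : w n * |aa (n - j)| ≤ M * w j := by
        calc w n * |aa (n - j)| ≤ w (n - j) * w j * |aa (n - j)| := by gcongr
          _ = (w (n - j) * |aa (n - j)|) * w j := by ring
          _ ≤ M * w j := mul_le_mul_of_nonneg_right h2 (w_pos j).le
      have h4 : |r| ^ j * |dd j| ≤ |r| ^ j :=
        mul_le_of_le_one_right (by positivity) (dd_abs_le j)
      calc _ ≤ M * w j * |r| ^ j :=
            mul_le_mul h3 h4 (by positivity) (mul_nonneg hM0 (w_pos j).le)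
        _ = _ := by ring
    · simp only [norm_zero]
      exact mul_nonneg hM0 (mul_nonneg (w_pos j).le (by positivity))

lemma conv_g_u (n : ℕ) (hn : n ≠ 1) : ∑ i ∈ Finset.range (n + 1), g r (n - i) * u r i = 0 := by
  have h := congrArg (coeff n) (G_mul_H1 r)
  rw [mul_comm, coeff_mul, Finset.Nat.sum_antidiagonal_eq_sum_range_succ
    (fun i j => coeff i (H1 r) * coeff j (G r)), coeff_X, if_neg hn] at h
  rw [← h]
  refine Finset.sum_congr rfl fun i _ => ?_
  simp [g, H1, mul_comm]

noncomputable def N (ν : ℤ → ℝ) : PowerSeries ℝ := PowerSeries.mk (fun j => ν (-(j : ℤ)))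

lemma tail_hasSum (ν : ℤ → ℝ) (hcrit : NuHarmonic ν (h1 r)) (k : ℕ) (hk : 1 ≤ k) :
    HasSum (fun m : ℕ => u r (k + m + 1) * ν ((m : ℤ) + 1)) (coeff k (H1 r - N ν * H1 r)) := by
  have hF := hcrit.2 k (by exact_mod_cast hk)
  set F : ℤ → ℝ := fun l => h1 r (k + l) * ν l with hFdef
  set P : ℤ → ℝ := fun l => if l ≤ 0 then F l else 0 with hP
  have hinj : Set.InjOn (fun j : ℕ => -(j : ℤ)) (Finset.range (k + 1) : Set ℕ) := by
    intro a _ b _ h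
    simpa using h
  have hPsum : HasSum P (coeff k (N ν * H1 r)) := by
    have : HasSum P (∑ l ∈ (Finset.range (k + 1)).image (fun j : ℕ => -(j : ℤ)), P l) := by
      apply hasSum_sum_of_ne_finset_zero
      intro l hl
      simp only [hP]
      split_ifs with h0
      · have : k + l ≤ 0 := by
          by_contra hcon
          apply hl
          rw [Finset.mem_image]
          refine ⟨(-l).toNat, ?_, ?_⟩
          · rw [Finset.mem_range]; omega
          · omega
        simp only [hFdef, h1]
        rw [if_neg (by omega), zero_mul]
      · rfl
    rw [Finset.sum_image hinj] at this
    convert this using 1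
    rw [coeff_mul, Finset.Nat.sum_antidiagonal_eq_sum_range_succ
      (fun i j => coeff i (N ν) * coeff j (H1 r))]
    refine Finset.sum_congr rfl fun j hj => ?_
    have hj' : j ≤ k := by simpa [Nat.lt_succ_iff] using hj
    simp only [hP, hFdef, N, H1, coeff_mk, u]
    rw [if_pos (by omega), mul_comm]
    congr 2
    omega
  have hsub := hF.sub hPsum
  have hinj2 : Function.Injective (fun m : ℕ => (m : ℤ) + 1) := by
    intro a b h
    simpa using h
  rw [← hinj2.hasSum_iff] at hsub
  · rw [map_sub]
    have e : coeff k (H1 r) = h1 r k := by simp [H1, u]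
    rw [e]
    refine hsub.congr_fun ?_
    intro m
    simp only [Function.comp, hP, hFdef, u]
    rw [if_neg (by omega), sub_zero]
    congr 2
  · intro l hl
    have : l ≤ 0 := by
      by_contra hcon
      exact hl ⟨(l - 1).toNat, by simp only []; omega⟩
    simp [hP, this]

lemma nu_hasSum (ν : ℤ → ℝ) (hcrit : NuHarmonic ν (h1 r)) (K : ℕ) (hK : 1 ≤ K) :
    HasSum (fun m : ℕ => (∑ i ∈ Finset.range (m + 2), g r (K + m + 2 - i) * u r i)
      * ν ((m : ℤ) + 1)) (ν (-(K : ℤ))) := by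
  have h1 : HasSum (fun m : ℕ => ∑ k ∈ Finset.range (K + 1),
      g r (K - k) * (u r (k + 1 + m + 1) * ν ((m : ℤ) + 1)))
      (∑ k ∈ Finset.range (K + 1), g r (K - k) * coeff (k + 1) (H1 r - N ν * H1 r)) :=
    hasSum_sum fun k _ => (tail_hasSum r ν hcrit (k + 1) (by omega)).mul_left _
  have h2 : ∑ k ∈ Finset.range (K + 1), g r (K - k) * coeff (k + 1) (H1 r - N ν * H1 r)
      = - ν (-(K : ℤ)) := by
    have e : (H1 r - N ν * H1 r) * G r = X - X * N ν := by
      have := G_mul_H1 r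
      linear_combination (1 - N ν) * this
    have h := congrArg (coeff (K + 1)) e
    rw [coeff_mul, Finset.Nat.sum_antidiagonal_eq_sum_range_succ
      (fun i j => coeff i (H1 r - N ν * H1 r) * coeff j (G r)), Finset.sum_range_succ',
      map_sub (coeff (K + 1)) X, coeff_succ_X_mul, coeff_X, if_neg (by omega)] at h
    have h0 : coeff 0 (H1 r - N ν * H1 r) = 0 := by simp [H1, u_zero]
    rw [h0, zero_mul, add_zero] at h
    have h3 : coeff K (N ν) = ν (-(K : ℤ)) := by simp [N]
    rw [h3, zero_sub] at h
    rw [← h]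
    refine Finset.sum_congr rfl fun k _ => ?_
    rw [mul_comm, g]
    congr 3
    omega
  rw [h2] at h1
  have h4 := h1.neg
  rw [neg_neg] at h4
  refine h4.congr_fun ?_
  intro m
  have hc := conv_g_u r (K + m + 2) (by omega)
  rw [show K + m + 2 + 1 = (m + 2) + (K + 1) by ring, Finset.sum_range_add] at hc
  rw [eq_neg_of_add_eq_zero_left hc, neg_mul, Finset.sum_mul]
  congr 1
  refine Finset.sum_congr rfl fun k _ => ?_
  rw [show K + m + 2 - (m + 2 + k) = K - k by omega, show m + 2 + k = k + 1 + m + 1 by ring]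
  ring

lemma main (hr : r ∈ Set.Ioo (-1 : ℝ) 1)
    (ν : ℤ → ℝ) (hprob : IsProbDist ν)
    (hcrit : NuHarmonic ν (h1 r))
    (hfin : Summable fun k : ℕ => ν ((k : ℤ) + 1) * h2 r ((k : ℤ) + 2)) :
    Filter.Tendsto (fun k : ℕ => (k : ℝ) ^ ((5 : ℝ) / 2) * ν (-(k : ℤ)))
      Filter.atTop
      (nhds (3 * Lnu r ν * Real.sqrt (1 + r) / (4 * Real.sqrt Real.pi))) := by
  have hg := tendsto_w_g r hr
  set κ := 3 / (4 * Real.sqrt Real.pi) * Real.sqrt (1 + r) with hκ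
  obtain ⟨M, hM0, hM⟩ := bdd_of_tendsto hg
  have hh2 : ∀ m : ℕ, h2 r ((m : ℤ) + 2) = ∑ i ∈ Finset.range (m + 2), u r i := by
    intro m
    have := h2_eq r (m + 1)
    rw [← this]
    congr 1
  have hlim : 3 * Lnu r ν * Real.sqrt (1 + r) / (4 * Real.sqrt Real.pi)
      = ∑' m : ℕ, κ * (ν ((m : ℤ) + 1) * h2 r ((m : ℤ) + 2)) := by
    rw [tsum_mul_left, hκ, Lnu]
    ring
  rw [hlim]
  have hb : Summable (fun m : ℕ => M * (ν ((m : ℤ) + 1) * h2 r ((m : ℤ) + 2))) :=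
    hfin.mul_left M
  have hu : ∀ i, 0 ≤ u r i := fun i => hcrit.1 i
  have key := tendsto_tsum_of_dominated_convergence (𝓕 := atTop)
    (f := fun K m : ℕ => (K : ℝ) ^ ((5 : ℝ) / 2) *
      ((∑ i ∈ Finset.range (m + 2), g r (K + m + 2 - i) * u r i) * ν ((m : ℤ) + 1)))
    (g := fun m : ℕ => κ * (ν ((m : ℤ) + 1) * h2 r ((m : ℤ) + 2))) hb ?_ ?_
  · refine key.congr' ?_
    filter_upwards [eventually_ge_atTop 1] with K hK
    rw [tsum_mul_left, (nu_hasSum r ν hcrit K hK).tsum_eq]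
  · intro m
    have hs : ∀ i ∈ Finset.range (m + 2), Tendsto (fun K : ℕ =>
        (K : ℝ) ^ ((5 : ℝ) / 2) * g r (K + m + 2 - i) * u r i * ν ((m : ℤ) + 1)) atTop
        (𝓝 (κ * u r i * ν ((m : ℤ) + 1))) := by
      intro i hi
      apply Tendsto.mul_const
      apply Tendsto.mul_const
      have hi' : i < m + 2 := Finset.mem_range.1 hi
      obtain ⟨s, hs⟩ := Nat.exists_eq_add_of_lt hi'
      have h1 := (tendsto_rpow_ratio 0 ((s + 1 : ℕ) + 1 : ℝ) le_rfl (by positivity)).mul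
        (hg.comp (tendsto_add_atTop_nat (s + 1)))
      rw [one_mul] at h1
      refine h1.congr fun K => ?_
      have e : K + m + 2 - i = K + (s + 1) := by omega
      have hw := (w_pos (K + (s + 1))).ne'
      have hw2 : w (K + (s + 1)) = ((K : ℝ) + ((s + 1 : ℕ) + 1)) ^ ((5 : ℝ) / 2) := by
        unfold w
        push_cast
        ring_nf
      rw [e, Function.comp, add_zero, ← hw2]
      field_simp
    have := tendsto_finsetSum (Finset.range (m + 2)) hs
    have e : ∑ i ∈ Finset.range (m + 2), κ * u r i * ν ((m : ℤ) + 1)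
        = κ * (ν ((m : ℤ) + 1) * h2 r ((m : ℤ) + 2)) := by
      rw [hh2, Finset.mul_sum, Finset.mul_sum]
      exact Finset.sum_congr rfl fun i _ => by ring
    rw [e] at this
    refine this.congr fun K => ?_
    rw [Finset.sum_mul, Finset.mul_sum]
    exact Finset.sum_congr rfl fun i _ => by ring
  · refine Eventually.of_forall fun K m => ?_
    have hν := hprob.1 ((m : ℤ) + 1)
    have hK0 : (0 : ℝ) ≤ (K : ℝ) ^ ((5 : ℝ) / 2) := by positivity
    rw [Real.norm_eq_abs, abs_mul, abs_mul, abs_of_nonneg hν, abs_of_nonneg hK0, hh2]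
    have hS : (K : ℝ) ^ ((5 : ℝ) / 2) *
        |∑ i ∈ Finset.range (m + 2), g r (K + m + 2 - i) * u r i|
        ≤ M * ∑ i ∈ Finset.range (m + 2), u r i := by
      calc _ ≤ (K : ℝ) ^ ((5 : ℝ) / 2) *
            ∑ i ∈ Finset.range (m + 2), |g r (K + m + 2 - i) * u r i| :=
            mul_le_mul_of_nonneg_left (Finset.abs_sum_le_sum_abs _ _) hK0
        _ ≤ _ := by
            rw [Finset.mul_sum, Finset.mul_sum]
            refine Finset.sum_le_sum fun i hi => ?_
            have hi' : i < m + 2 := Finset.mem_range.1 hi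
            rw [abs_mul, abs_of_nonneg (hu i), ← mul_assoc]
            refine mul_le_mul_of_nonneg_right ?_ (hu i)
            refine le_trans ?_ (hM (K + m + 2 - i))
            rw [abs_mul, abs_of_pos (w_pos _)]
            refine mul_le_mul_of_nonneg_right ?_ (abs_nonneg _)
            unfold w
            apply Real.rpow_le_rpow (by positivity) _ (by norm_num)
            have : K ≤ K + m + 2 - i + 1 := by omega
            exact_mod_cast this
    calc _ = ((K : ℝ) ^ ((5 : ℝ) / 2) *
        |∑ i ∈ Finset.range (m + 2), g r (K + m + 2 - i) * u r i|) * ν ((m : ℤ) + 1) := by ring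
      _ ≤ (M * ∑ i ∈ Finset.range (m + 2), u r i) * ν ((m : ℤ) + 1) :=
          mul_le_mul_of_nonneg_right hS hν
      _ = _ := by ring

end Stmt13Aux

/-- negative tail asymptotics of a critical `ν` with `𝓛_ν < ∞`. -/
theorem stmt13 (r : ℝ) (hr : r ∈ Set.Ioo (-1 : ℝ) 1)
    (ν : ℤ → ℝ) (hprob : IsProbDist ν)
    (hcrit : NuHarmonic ν (h1 r))
    (hfin : Summable fun k : ℕ => ν ((k : ℤ) + 1) * h2 r ((k : ℤ) + 2)) :
    Filter.Tendsto (fun k : ℕ => (k : ℝ) ^ ((5 : ℝ) / 2) * ν (-(k : ℤ)))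
      Filter.atTop
      (nhds (3 * Lnu r ν * Real.sqrt (1 + r) / (4 * Real.sqrt Real.pi))) := by
  exact Stmt13Aux.main r hr ν hprob hcrit hfin
end

section
/- For all real numbers x ≥ 0, y ≥ 0 and z > y + 2√x, the double series ∑_{l=0}^∞ z^{-l-1} ∑_{k=0}^{⌊l/2⌋} (l! / (k!·k!·(l-2k)!)) · x^k · y^{l-2k} converges and equals 1/√((z-y)² - 4x). -/
open scoped BigOperators

lemma aux_central (n : ℕ) :
    Ring.choose ((1/2 : ℝ) + n - 1) n * 4 ^ n = (Nat.centralBinom n : ℝ) := by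
  rw [← Ring.multichoose_eq]
  have h : ∀ n : ℕ, (ascPochhammer ℕ n).smeval (1/2 : ℝ) * 4 ^ n
      = n.factorial * (Nat.centralBinom n : ℝ) := by
    intro n
    induction n with
    | zero => simp
    | succ n ih =>
      have hc : ((n : ℝ) + 1) * (Nat.centralBinom (n+1) : ℝ)
          = 2 * (2 * n + 1) * (Nat.centralBinom n : ℝ) := by
        exact_mod_cast Nat.succ_mul_centralBinom_succ n
      rw [ascPochhammer_succ_right, Polynomial.smeval_mul, Polynomial.smeval_add,
        Polynomial.smeval_X, Polynomial.smeval_natCast, Nat.factorial_succ]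
      push_cast
      simp only [pow_one, pow_zero, nsmul_eq_mul, mul_one]
      linear_combination (4 * (1/2 + (n:ℝ))) * ih - (n.factorial : ℝ) * hc
  have h2 := h n
  rw [← Ring.factorial_nsmul_multichoose_eq_ascPochhammer, nsmul_eq_mul, mul_assoc] at h2
  exact mul_left_cancel₀ (by positivity) h2

lemma aux_series (w : ℝ) (h0w : 0 ≤ w) (hw : 4 * w < 1) :
    HasSum (fun n : ℕ => (Nat.centralBinom n : ℝ) * w ^ n) (1 / Real.sqrt (1 - 4 * w)) := by
  have h := (Real.one_div_one_sub_rpow_hasFPowerSeriesOnBall_zero (1/2)).hasSum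
    (y := 4 * w) (by
      simp only [Metric.mem_eball, edist_zero_right]
      rw [Real.enorm_eq_ofReal (by positivity)]
      exact ENNReal.ofReal_lt_one.2 hw)
  rw [zero_add, ← Real.sqrt_eq_rpow] at h
  convert! h using 1
  ext n
  rw [FormalMultilinearSeries.ofScalars_apply_eq, ← aux_central n, smul_eq_mul, mul_pow]
  ring

lemma aux_row (x y z : ℝ) (hy : 0 ≤ y) (hz : y < z) (k : ℕ) :
    HasSum (fun l : ℕ => if 2 * k ≤ l then z ^ (-(l : ℤ) - 1) *
          (((l.factorial : ℝ) /
              ((k.factorial : ℝ) * (k.factorial : ℝ) * ((l - 2 * k).factorial : ℝ))) *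
            x ^ k * y ^ (l - 2 * k)) else 0)
      ((z - y)⁻¹ * ((Nat.centralBinom k : ℝ) * (x / (z - y) ^ 2) ^ k)) := by
  have hz0 : 0 < z := by linarith
  have hzy : 0 < z - y := by linarith
  have h := (hasSum_choose_mul_geometric_of_norm_lt_one (2 * k) (r := y / z) (by
    rw [Real.norm_of_nonneg (by positivity), div_lt_one hz0]; exact hz)).mul_left
      ((Nat.centralBinom k : ℝ) * x ^ k * (z ^ (2 * k + 1))⁻¹)
  rw [← Function.Injective.hasSum_iff (add_left_injective (2 * k))]
  · convert! h using 1
    · ext m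
      simp only [Function.comp]
      rw [if_pos (by omega), Nat.add_sub_cancel]
      have e : z ^ (-((m + 2 * k : ℕ) : ℤ) - 1) = (z ^ (2 * k + 1))⁻¹ * (z ^ m)⁻¹ := by
        rw [← mul_inv, ← pow_add, ← zpow_natCast, ← zpow_neg]
        congr 1
        push_cast
        ring
      have e1 : ((m + 2 * k).choose (2 * k) : ℝ) * (2 * k).factorial * m.factorial
          = (m + 2 * k).factorial := by
        have := Nat.choose_mul_factorial_mul_factorial (show 2 * k ≤ m + 2 * k by omega)
        rw [Nat.add_sub_cancel] at this
        exact_mod_cast this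
      have e2 : (Nat.centralBinom k : ℝ) * k.factorial * k.factorial = (2 * k).factorial := by
        have := Nat.choose_mul_factorial_mul_factorial (show k ≤ 2 * k by omega)
        rw [show 2 * k - k = k by omega] at this
        exact_mod_cast this
      rw [e, ← e1, ← e2, div_pow]
      field_simp
    · have : 1 - y / z = (z - y) / z := by field_simp
      rw [this, div_pow, div_pow, ← pow_mul]
      field_simp
      ring
  · intro l hl
    rw [if_neg]
    intro hk
    exact hl ⟨l - 2 * k, by simp; omega⟩

/-- generating function of the trinomial sums. -/
theorem stmt17 (x y z : ℝ) (hx : 0 ≤ x) (hy : 0 ≤ y) (hz : y + 2 * Real.sqrt x < z) :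
    HasSum
      (fun l : ℕ => z ^ (-(l : ℤ) - 1) *
        ∑ k ∈ Finset.range (l / 2 + 1),
          ((l.factorial : ℝ) /
              ((k.factorial : ℝ) * (k.factorial : ℝ) * ((l - 2 * k).factorial : ℝ))) *
            x ^ k * y ^ (l - 2 * k))
      (1 / Real.sqrt ((z - y) ^ 2 - 4 * x)) := by
  have hs := Real.sqrt_nonneg x
  have hsx := Real.sq_sqrt hx
  have hyz : y < z := by linarith
  have hz0 : 0 < z := by linarith
  have hzy : 0 < z - y := by linarith
  have h4 : 4 * x < (z - y) ^ 2 := by nlinarith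
  set F : ℕ × ℕ → ℝ := fun p => if 2 * p.1 ≤ p.2 then z ^ (-(p.2 : ℤ) - 1) *
          (((p.2.factorial : ℝ) /
              ((p.1.factorial : ℝ) * (p.1.factorial : ℝ) * ((p.2 - 2 * p.1).factorial : ℝ))) *
            x ^ p.1 * y ^ (p.2 - 2 * p.1)) else 0 with hF
  have hF0 : 0 ≤ F := by
    intro p
    simp only [hF, Pi.zero_apply]
    split_ifs <;> positivity
  have hrow : ∀ k, HasSum (fun l => F (k, l))
      ((z - y)⁻¹ * ((Nat.centralBinom k : ℝ) * (x / (z - y) ^ 2) ^ k)) :=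
    fun k => aux_row x y z hy hyz k
  have hcol := (aux_series (x / (z - y) ^ 2) (by positivity) (by
    rw [← mul_div_assoc, div_lt_one (by positivity)]; exact h4)).mul_left (z - y)⁻¹
  have hval : (z - y)⁻¹ * (1 / Real.sqrt (1 - 4 * (x / (z - y) ^ 2)))
      = 1 / Real.sqrt ((z - y) ^ 2 - 4 * x) := by
    have : (z - y) ^ 2 - 4 * x = (z - y) ^ 2 * (1 - 4 * (x / (z - y) ^ 2)) := by
      field_simp
    rw [this, Real.sqrt_mul (by positivity), Real.sqrt_sq hzy.le, one_div, one_div, mul_inv]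
  rw [hval] at hcol
  have hsum : Summable F := by
    rw [summable_prod_of_nonneg hF0]
    refine ⟨fun k => (hrow k).summable, ?_⟩
    simp only [(hrow _).tsum_eq]
    exact hcol.summable
  have hF1 : HasSum F (1 / Real.sqrt ((z - y) ^ 2 - 4 * x)) := by
    have h1 := hsum.hasSum
    rwa [(h1.prod_fiberwise hrow).unique hcol] at h1
  have hF2 := (Equiv.prodComm ℕ ℕ).hasSum_iff.2 hF1
  refine hF2.prod_fiberwise (fun l => ?_)
  rw [Finset.mul_sum]
  have : ∀ k ∈ Finset.range (l / 2 + 1), z ^ (-(l : ℤ) - 1) *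
          (((l.factorial : ℝ) /
              ((k.factorial : ℝ) * (k.factorial : ℝ) * ((l - 2 * k).factorial : ℝ))) *
            x ^ k * y ^ (l - 2 * k)) = F (k, l) := by
    intro k hk
    rw [Finset.mem_range] at hk
    simp only [hF]
    rw [if_pos (by omega)]
  rw [Finset.sum_congr rfl this]
  apply hasSum_sum_of_ne_finset_zero
  intro k hk
  rw [Finset.mem_range] at hk
  simp only [hF, Function.comp, Equiv.prodComm_apply, Prod.swap]
  rw [if_neg (by omega)]
end
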